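/- Let k be an algebraically closed field, let n ≥ 3, and let X = {{1,2},{2,3},…,{n−1,n},{n,1}} be the generating pattern on [n] encoding the edge ideal (x_1x_2, x_2x_3, …, x_nx_1) of the n-cycle. If n ≡ 2 (mod 4), then V_X = V(χ_1χ_3⋯χ_{n−1} + χ_2χ_4⋯χ_n) ⊆ k^n; if n ≢ 2 (mod 4), then V_X = k^n. -/

import Mathlib

open scoped Classical

noncomputable section

/-- A *generating pattern* on `[n]`: a finite set `X` of nonempty subsets of `Fin n`
such that for all `i ≠ j` there is `σ ∈ X` with `i ∈ σ` and `j ∉ σ`. -/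
def IsGenPattern (n : ℕ) (X : Finset (Finset (Fin n))) : Prop :=
  (∀ σ ∈ X, σ.Nonempty) ∧ ∀ i j : Fin n, i ≠ j → ∃ σ ∈ X, i ∈ σ ∧ j ∉ σ

/-- Adjacency in the GCD graph of a generating pattern. -/
def GcdAdj {n : ℕ} (X : Finset (Finset (Fin n))) (i j : Fin n) : Prop :=
  i ≠ j ∧ ∃ σ ∈ X, i ∈ σ ∧ j ∈ σ

/-- The neighborhood of a set of vertices in the GCD graph. -/
def Nbhd {n : ℕ} (X : Finset (Finset (Fin n))) (S : Finset (Fin n)) : Finset (Fin n) :=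
  Finset.univ.filter fun j => ∃ i ∈ S, GcdAdj X i j

/-- The differential edge `d_{σ,i}` (from `σ ∪ {i}` to `σ`) exists. -/
def DiffEdge {n : ℕ} (X : Finset (Finset (Fin n))) (σ : Finset (Fin n)) (i : Fin n) : Prop :=
  i ∉ σ ∧ ∀ τ ∈ X, i ∈ τ → (τ ∩ σ).Nonempty

/-- The homotopy edge `h_{σ,i}` (from `σ` to `σ ∪ {i}`) exists. -/
def HomEdge {n : ℕ} (X : Finset (Finset (Fin n))) (σ : Finset (Fin n)) (i : Fin n) : Prop :=
  i ∉ σ ∧ i ∉ Nbhd X σ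

/-- `sign(σ, i) = (-1)^{|{j ∈ σ : j < i}|}`. -/
def edgeSign {n : ℕ} (σ : Finset (Fin n)) (i : Fin n) : ℤ :=
  (-1) ^ (σ.filter fun j => j < i).card

/-- The Taylor matrix of the generating pattern `X`, evaluated at the point `a : Fin n → k`. -/
def taylorMatrixAt {n : ℕ} {k : Type*} [Field k] (X : Finset (Finset (Fin n)))
    (a : Fin n → k) : Matrix (Finset (Fin n)) (Finset (Fin n)) k :=
  fun r c =>
    (∑ i : Fin n, if c = insert i r ∧ DiffEdge X r i then (edgeSign r i : k) else 0) +
      ∑ i : Fin n, if r = insert i c ∧ HomEdge X c i then (edgeSign c i : k) * a i else 0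

/-- The cohomological support variety `V_X ⊆ k^n`: the locus where all
`2^(n-1) × 2^(n-1)` minors of the Taylor matrix vanish. -/
def supportVariety {n : ℕ} (k : Type*) [Field k] (X : Finset (Finset (Fin n))) :
    Set (Fin n → k) :=
  { a | ∀ f g : Fin (2 ^ (n - 1)) → Finset (Fin n),
      Function.Injective f → Function.Injective g →
      ((taylorMatrixAt X a).submatrix f g).det = 0 }

/-- The generating pattern `{{1,2},{2,3},…,{n,1}}` encoding the edge ideal of the `n`-cycle. -/
def cycleEdges (n : ℕ) [NeZero n] : Finset (Finset (Fin n)) :=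
  Finset.univ.image fun i : Fin n => ({i, i + 1} : Finset (Fin n))

theorem exists_rows {k : Type*} [Field k] {m ι : Type*} [Fintype m] [Fintype ι]
    (A : Matrix m ι k) (r : ℕ) (h : r ≤ A.rank) :
    ∃ f : Fin r → m, Function.Injective f ∧ LinearIndependent k (A.submatrix f id).row := by
  rw [A.rank_eq_finrank_span_row] at h
  obtain ⟨f, hf, -, hli⟩ := Submodule.exists_fun_fin_finrank_span_eq k (Set.range A.row)
  choose g hg using hf
  have hli' : LinearIndependent k (fun i : Fin r => A.row (g (Fin.castLE h i))) := by
    have := hli.comp (Fin.castLE h) (Fin.castLE_injective h)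
    have e : (fun i : Fin r => A.row (g (Fin.castLE h i))) = f ∘ Fin.castLE h := by
      funext i; simp [hg]
    rw [e]; exact this
  refine ⟨fun i => g (Fin.castLE h i), ?_, hli'⟩
  intro i j hij
  apply hli'.injective
  simp only at hij ⊢
  rw [hij]

theorem minors_iff {k : Type*} [Field k] {ι : Type*} [Fintype ι]
    (A : Matrix ι ι k) (r : ℕ) :
    (∀ f g : Fin r → ι, Function.Injective f → Function.Injective g →
      (A.submatrix f g).det = 0) ↔ A.rank < r := by
  constructor
  · intro H
    by_contra! hr
    obtain ⟨f, hf, hfl⟩ := exists_rows A r hr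
    have h1 := hfl.rank_matrix
    rw [← Matrix.rank_transpose, Fintype.card_fin] at h1
    obtain ⟨g, hg, hgl⟩ := exists_rows _ r h1.ge
    have h2 := H f g hf hg
    have h3 : IsUnit (((A.submatrix f id).transpose.submatrix g id)) :=
      Matrix.linearIndependent_rows_iff_isUnit.mp hgl
    have h4 : ((A.submatrix f id).transpose.submatrix g id) = (A.submatrix f g).transpose := by
      ext i j; rfl
    rw [h4, Matrix.isUnit_iff_isUnit_det, Matrix.det_transpose, h2] at h3
    exact not_isUnit_zero h3
  · intro hr f g _ _
    by_contra hdet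
    have := Matrix.rank_of_det_ne_zero hdet
    have h2 := A.rank_submatrix_le f g
    rw [Fintype.card_fin] at this
    omega

theorem rank_lt_iff {k : Type*} [Field k] {ι : Type*} [Fintype ι]
    (A : Matrix ι ι k) (r : ℕ) (hc : Fintype.card ι = 2 * r) (hA : A * A = 0) :
    A.rank < r ↔ ∃ v, A.mulVec v = 0 ∧ ∀ u, A.mulVec u ≠ v := by
  have hle : LinearMap.range A.mulVecLin ≤ LinearMap.ker A.mulVecLin := by
    rw [LinearMap.range_le_ker_iff, ← Matrix.mulVecLin_mul, hA]; simp
  have hd := LinearMap.finrank_range_add_finrank_ker A.mulVecLin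
  rw [Module.finrank_fintype_fun_eq_card, hc] at hd
  have hrk : A.rank = Module.finrank k (LinearMap.range A.mulVecLin) := rfl
  constructor
  · intro h
    by_contra! hx
    have : LinearMap.range A.mulVecLin = LinearMap.ker A.mulVecLin := by
      apply le_antisymm hle
      intro v hv
      obtain ⟨u, hu⟩ := hx v hv
      exact ⟨u, hu⟩
    rw [← this] at hd
    omega
  · rintro ⟨v, hv, hvu⟩
    have : LinearMap.range A.mulVecLin < LinearMap.ker A.mulVecLin := by
      refine lt_of_le_of_ne hle fun he => ?_
      have : v ∈ LinearMap.range A.mulVecLin := by rw [he]; exact hv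
      obtain ⟨u, hu⟩ := this
      exact hvu u hu
    have := Submodule.finrank_lt_finrank_of_lt this
    omega

theorem rank_add_le' {k : Type*} [Field k] {ι : Type*} [Fintype ι]
    (A B : Matrix ι ι k) : (A + B).rank ≤ A.rank + B.rank := by
  unfold Matrix.rank
  rw [Matrix.mulVecLin_add]
  refine le_trans (Submodule.finrank_mono (LinearMap.range_add_le _ _)) ?_
  exact Submodule.finrank_add_le_finrank_add_finrank _ _

theorem rank_le_half {k : Type*} [Field k] {ι : Type*} [Fintype ι]
    (A : Matrix ι ι k) (hA : A * A = 0) (O : ι → Prop)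
    (hO : ∀ r c, A r c ≠ 0 → (O r ↔ ¬ O c)) : A.rank ≤ Fintype.card {i // O i} := by
  set X : Matrix ι {i // O i} k := A.submatrix id Subtype.val with hX
  set Y : Matrix {i // O i} ι k := A.submatrix Subtype.val id with hY
  have hXY : X * Y = 0 := by
    ext r c
    by_cases hc : O c
    · rw [Matrix.mul_apply]
      apply Finset.sum_eq_zero
      rintro ⟨m, hm⟩ -
      have : A m c = 0 := by
        by_contra h
        exact (hO m c h).mp hm hc
      simp [hX, hY, this]
    · have h2 := congrFun (congrFun hA r) c
      rw [Matrix.mul_apply] at h2 ⊢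
      rw [← Fintype.sum_subtype_add_sum_subtype O] at h2
      have h3 : ∑ i : {i // ¬ O i}, A r i * A i c = 0 := by
        apply Finset.sum_eq_zero
        rintro ⟨m, hm⟩ -
        have : A m c = 0 := by
          by_contra h
          exact hm ((hO m c h).mpr hc)
        simp [this]
      rw [h3, add_zero] at h2
      exact h2
  have h1 := Matrix.rank_add_rank_le_card_of_mul_eq_zero hXY
  refine le_trans ?_ h1
  have hdec : A = X * (Matrix.of fun (i : {i // O i}) (j : ι) => if (i : ι) = j then (1:k) else 0)
      + (Matrix.of fun (j : ι) (i : {i // O i}) => if (i : ι) = j then (1:k) else 0) * Y := by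
    ext r c
    rw [Matrix.add_apply, Matrix.mul_apply, Matrix.mul_apply]
    by_cases hc : O c <;> by_cases hr : O r
    · have : A r c = 0 := by
        by_contra h
        exact (hO r c h).mp hr hc
      rw [Finset.sum_eq_single ⟨c, hc⟩, Finset.sum_eq_single ⟨r, hr⟩] <;> simp_all
    · rw [Finset.sum_eq_single ⟨c, hc⟩, Finset.sum_eq_zero] <;> simp_all
      grind
    · rw [Finset.sum_eq_zero, Finset.sum_eq_single ⟨r, hr⟩] <;> simp_all
      grind
    · have : A r c = 0 := by
        by_contra h
        have := hO r c h
        tauto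
      rw [Finset.sum_eq_zero, Finset.sum_eq_zero] <;> simp_all
  conv_lhs => rw [hdec]
  refine le_trans (rank_add_le' _ _) ?_
  exact add_le_add (Matrix.rank_mul_le_left _ _) (Matrix.rank_mul_le_right _ _)

def fl {n : ℕ} (σ : Finset (Fin n)) (i : Fin n) : Finset (Fin n) := symmDiff σ {i}

theorem mem_fl {n : ℕ} (σ : Finset (Fin n)) (i j : Fin n) :
    j ∈ fl σ i ↔ ¬ (j ∈ σ ↔ j = i) := by
  simp only [fl, Finset.mem_symmDiff, Finset.mem_singleton]; tauto

theorem mem_fl_self {n : ℕ} (σ : Finset (Fin n)) (i : Fin n) :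
    i ∈ fl σ i ↔ i ∉ σ := by
  rw [mem_fl]; tauto

theorem mem_fl_ne {n : ℕ} (σ : Finset (Fin n)) {i j : Fin n} (h : j ≠ i) :
    j ∈ fl σ i ↔ j ∈ σ := by
  rw [mem_fl]; tauto

theorem fl_fl {n : ℕ} (σ : Finset (Fin n)) (i : Fin n) : fl (fl σ i) i = σ := by
  ext j; rw [mem_fl, mem_fl]; tauto

theorem fl_comm {n : ℕ} (σ : Finset (Fin n)) (i j : Fin n) :
    fl (fl σ i) j = fl (fl σ j) i := by
  ext l; simp only [mem_fl]; tauto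

theorem edgeSign_prod {n : ℕ} (σ : Finset (Fin n)) (i : Fin n) :
    edgeSign σ i = ∏ j ∈ Finset.univ.filter (fun j => j < i), if j ∈ σ then (-1 : ℤ) else 1 := by
  rw [Finset.prod_ite]
  simp only [Finset.prod_const, one_pow, mul_one, edgeSign]
  congr 2
  ext j; simp [and_comm]

theorem edgeSign_fl {n : ℕ} (σ : Finset (Fin n)) (i j : Fin n) :
    edgeSign (fl σ j) i = if j < i then - edgeSign σ i else edgeSign σ i := by
  rw [edgeSign_prod, edgeSign_prod]
  split_ifs with h
  · have hj : j ∈ Finset.univ.filter (fun j => j < i) := by simp [h]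
    rw [← Finset.mul_prod_erase _ _ hj, ← Finset.mul_prod_erase _ _ hj]
    have : ∀ l ∈ (Finset.univ.filter (fun j => j < i)).erase j,
        (if l ∈ fl σ j then (-1 : ℤ) else 1) = if l ∈ σ then (-1 : ℤ) else 1 := by
      intro l hl
      simp only [mem_fl_ne _ (Finset.ne_of_mem_erase hl)]
    rw [Finset.prod_congr rfl this]
    simp only [mem_fl_self]
    by_cases hs : j ∈ σ <;> simp [hs]
  · apply Finset.prod_congr rfl
    intro l hl
    have hlj : l ≠ j := by
      rintro rfl
      simp at hl; exact h hl
    simp only [mem_fl_ne _ hlj]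

theorem edgeSign_sq {n : ℕ} (σ : Finset (Fin n)) (i : Fin n) :
    edgeSign σ i * edgeSign σ i = 1 := by
  unfold edgeSign
  rw [← pow_add, ← two_mul, pow_mul]; simp

def sg {n : ℕ} (k : Type*) [Field k] (i : Fin n) (σ : Finset (Fin n)) : k := (edgeSign σ i : k)

section sg
variable {n : ℕ} {k : Type*} [Field k]

theorem sg_sq (i : Fin n) (σ : Finset (Fin n)) : sg k i σ * sg k i σ = 1 := by
  unfold sg; rw [← Int.cast_mul, edgeSign_sq, Int.cast_one]

theorem sg_fl_self (i : Fin n) (σ : Finset (Fin n)) : sg k i (fl σ i) = sg k i σ := by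
  unfold sg; rw [edgeSign_fl]; simp

theorem sg_exchange {i j : Fin n} (h : i ≠ j) (σ : Finset (Fin n)) :
    sg k i σ * sg k j (fl σ i) = - (sg k j σ * sg k i (fl σ j)) := by
  unfold sg
  rw [edgeSign_fl, edgeSign_fl]
  rcases lt_or_gt_of_ne h with h' | h'
  · simp [h', not_lt.mpr h'.le, mul_comm]
  · simp [h', not_lt.mpr h'.le, mul_comm]

/-- signed flip operator with coefficient function `φ`. -/
def opr (φ : Fin n → Finset (Fin n) → k) : (Finset (Fin n) → k) →ₗ[k] (Finset (Fin n) → k) where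
  toFun v σ := ∑ i, sg k i σ * φ i σ * v (fl σ i)
  map_add' u v := by
    funext σ; simp only [Pi.add_apply, mul_add, Finset.sum_add_distrib]
  map_smul' c v := by
    funext σ; simp only [Pi.smul_apply, smul_eq_mul, RingHom.id_apply, Finset.mul_sum]
    apply Finset.sum_congr rfl; intro i _; ring

theorem opr_apply (φ : Fin n → Finset (Fin n) → k) (v : Finset (Fin n) → k) (σ) :
    opr φ v σ = ∑ i, sg k i σ * φ i σ * v (fl σ i) := rfl

theorem opr_sq (φ : Fin n → Finset (Fin n) → k) (c : Fin n → k)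
    (h1 : ∀ i σ, φ i σ * φ i (fl σ i) = c i)
    (h2 : ∀ i j σ, i ≠ j → φ i σ * φ j (fl σ i) = φ j σ * φ i (fl σ j))
    (v : Finset (Fin n) → k) : opr φ (opr φ v) = (∑ i, c i) • v := by
  funext σ
  simp only [opr_apply, Pi.smul_apply, smul_eq_mul, Finset.mul_sum]
  rw [← Finset.univ.sum_product' Finset.univ
    (fun i j => sg k i σ * φ i σ * (sg k j (fl σ i) * φ j (fl σ i) * v (fl (fl σ i) j))),
    ← Finset.sum_filter_add_sum_filter_not _ (fun p : Fin n × Fin n => p.1 = p.2)]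
  have hz : ∑ p ∈ (Finset.univ ×ˢ Finset.univ).filter (fun p : Fin n × Fin n => ¬ p.1 = p.2),
    sg k p.1 σ * φ p.1 σ * (sg k p.2 (fl σ p.1) * φ p.2 (fl σ p.1) * v (fl (fl σ p.1) p.2)) = 0 := by
    apply Finset.sum_involution (fun p _ => (p.2, p.1))
    · rintro ⟨i, j⟩ h
      simp only [Finset.mem_filter] at h
      have e1 := sg_exchange (k := k) h.2 σ
      have e2 := h2 i j σ h.2
      simp only at e1 e2 ⊢
      rw [fl_comm σ j i]
      linear_combination (φ i σ * φ j (fl σ i) * v (fl (fl σ i) j)) * e1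
        - (sg k j σ * sg k i (fl σ j) * v (fl (fl σ i) j)) * e2
    · rintro ⟨i, j⟩ h _ he
      simp only [Finset.mem_filter] at h
      simp only [Prod.mk.injEq] at he
      exact h.2 he.2
    · rintro ⟨i, j⟩ h
      simp only [Finset.mem_filter] at h ⊢
      exact ⟨by simp, fun e => h.2 e.symm⟩
    · rintro ⟨i, j⟩ h; rfl
  rw [hz, add_zero, Finset.sum_mul]
  symm
  apply Finset.sum_bij (fun i _ => (i, i))
  · intro i _; simp
  · intro i _ j _ h; simpa using h
  · rintro ⟨i, j⟩ h
    simp only [Finset.mem_filter] at h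
    exact ⟨i, Finset.mem_univ _, by simp [h.2]⟩
  · intro i _
    simp only
    rw [fl_fl, sg_fl_self, ← h1 i σ]
    linear_combination (-(φ i σ * φ i (fl σ i) * v σ)) * sg_sq (k := k) i σ

end sg
section cyc
variable {n : ℕ} [NeZero n] {k : Type*} [Field k]

theorem fin_one_ne (hn : 3 ≤ n) : (1 : Fin n) ≠ 0 := by
  intro h
  have := congrArg Fin.val h
  rw [Fin.val_zero, Fin.val_one', Nat.mod_eq_of_lt (by omega)] at this
  omega

theorem fin_two_ne (hn : 3 ≤ n) : (1 + 1 : Fin n) ≠ 0 := by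
  intro h
  have := congrArg Fin.val h
  rw [Fin.val_zero, Fin.val_add, Fin.val_one', Nat.mod_eq_of_lt (a := 1) (by omega),
    Nat.mod_eq_of_lt (by omega)] at this
  omega

theorem ne1 (hn : 3 ≤ n) (i : Fin n) : i + 1 ≠ i := by
  intro h; exact fin_one_ne hn (by simpa using h)

theorem ne2 (hn : 3 ≤ n) (i : Fin n) : i - 1 ≠ i := by
  intro h; exact fin_one_ne hn (by simpa using h)

theorem ne3 (hn : 3 ≤ n) (i : Fin n) : i + 1 ≠ i - 1 := by
  intro h; apply fin_two_ne hn
  have : i + 1 + 1 = i := by rw [h]; abel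
  rw [add_assoc] at this
  simpa using this

theorem mem_cycleEdges (τ : Finset (Fin n)) :
    τ ∈ cycleEdges n ↔ ∃ i : Fin n, τ = {i, i + 1} := by
  simp [cycleEdges, eq_comm]

theorem diffEdge_iff (hn : 3 ≤ n) (σ : Finset (Fin n)) (i : Fin n) :
    DiffEdge (cycleEdges n) σ i ↔ i ∉ σ ∧ i - 1 ∈ σ ∧ i + 1 ∈ σ := by
  unfold DiffEdge
  constructor
  · rintro ⟨h, H⟩
    refine ⟨h, ?_, ?_⟩
    · obtain ⟨x, hx⟩ := H {i - 1, i - 1 + 1} ((mem_cycleEdges _).mpr ⟨_, rfl⟩) (by simp)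
      simp only [sub_add_cancel, Finset.mem_inter, Finset.mem_insert, Finset.mem_singleton] at hx
      rcases hx with ⟨rfl | rfl, h2⟩
      · exact h2
      · exact absurd h2 h
    · obtain ⟨x, hx⟩ := H {i, i + 1} ((mem_cycleEdges _).mpr ⟨_, rfl⟩) (by simp)
      simp only [Finset.mem_inter, Finset.mem_insert, Finset.mem_singleton] at hx
      rcases hx with ⟨rfl | rfl, h2⟩
      · exact absurd h2 h
      · exact h2
  · rintro ⟨h, h1, h2⟩
    refine ⟨h, fun τ hτ hi => ?_⟩
    obtain ⟨j, rfl⟩ := (mem_cycleEdges _).mp hτ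
    simp only [Finset.mem_insert, Finset.mem_singleton] at hi
    rcases hi with rfl | rfl
    · exact ⟨i + 1, by simp [h2]⟩
    · exact ⟨j, by simpa using h1⟩

theorem gcdAdj_iff (hn : 3 ≤ n) (i j : Fin n) :
    GcdAdj (cycleEdges n) i j ↔ (i = j - 1 ∨ i = j + 1) := by
  unfold GcdAdj
  constructor
  · rintro ⟨h, τ, hτ, hi, hj⟩
    obtain ⟨l, rfl⟩ := (mem_cycleEdges _).mp hτ
    simp only [Finset.mem_insert, Finset.mem_singleton] at hi hj
    rcases hi with rfl | rfl <;> rcases hj with rfl | rfl <;> simp_all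
  · rintro (rfl | rfl)
    · exact ⟨ne2 hn j, {j - 1, j - 1 + 1}, (mem_cycleEdges _).mpr ⟨_, rfl⟩, by simp, by simp⟩
    · exact ⟨ne1 hn j, {j, j + 1}, (mem_cycleEdges _).mpr ⟨_, rfl⟩, by simp, by simp⟩

theorem homEdge_iff (hn : 3 ≤ n) (σ : Finset (Fin n)) (i : Fin n) :
    HomEdge (cycleEdges n) σ i ↔ i ∉ σ ∧ i - 1 ∉ σ ∧ i + 1 ∉ σ := by
  unfold HomEdge Nbhd
  simp only [Finset.mem_filter, Finset.mem_univ, true_and, gcdAdj_iff hn]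
  constructor
  · rintro ⟨h, H⟩
    exact ⟨h, fun h1 => H ⟨_, h1, Or.inl rfl⟩, fun h1 => H ⟨_, h1, Or.inr rfl⟩⟩
  · rintro ⟨h, h1, h2⟩
    refine ⟨h, ?_⟩
    rintro ⟨j, hj, rfl | rfl⟩
    · exact h1 hj
    · exact h2 hj

/-- bond factor -/
def kap (x : Fin n → k) (σ : Finset (Fin n)) (b : Fin n) : k :=
  if (b ∈ σ ↔ b + 1 ∈ σ) then x b else 1

def Am (a : Fin n → k) (i : Fin n) (σ : Finset (Fin n)) : k := if i ∈ σ then a i else 1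

def ph (a x : Fin n → k) (i : Fin n) (σ : Finset (Fin n)) : k :=
  Am a i σ * (kap x σ (i - 1) * kap x σ i)

theorem Am_fl (a : Fin n → k) {i j : Fin n} (h : i ≠ j) (σ : Finset (Fin n)) :
    Am a i (fl σ j) = Am a i σ := by
  unfold Am; simp only [mem_fl_ne σ h]

theorem Am_self (a : Fin n → k) (i : Fin n) (σ : Finset (Fin n)) :
    Am a i σ * Am a i (fl σ i) = a i := by
  unfold Am; simp only [mem_fl_self]
  by_cases h : i ∈ σ <;> simp [h]

theorem kap_fl (x : Fin n → k) {b j : Fin n} (h : b ≠ j) (h' : b + 1 ≠ j) (σ : Finset (Fin n)) :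
    kap x (fl σ j) b = kap x σ b := by
  unfold kap; simp only [mem_fl_ne σ h, mem_fl_ne σ h']

theorem kap_left (hn : 3 ≤ n) (x : Fin n → k) (b : Fin n) (σ : Finset (Fin n)) :
    kap x σ b * kap x (fl σ b) b = x b := by
  unfold kap; simp only [mem_fl_self, mem_fl_ne σ (ne1 hn b)]
  by_cases h : b ∈ σ <;> by_cases h' : b + 1 ∈ σ <;> simp [h, h']

theorem kap_right (hn : 3 ≤ n) (x : Fin n → k) (b : Fin n) (σ : Finset (Fin n)) :
    kap x σ b * kap x (fl σ (b + 1)) b = x b := by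
  unfold kap; simp only [mem_fl_self, mem_fl_ne σ (ne1 hn b).symm]
  by_cases h : b ∈ σ <;> by_cases h' : b + 1 ∈ σ <;> simp [h, h']

theorem ph_diag (hn : 3 ≤ n) (a x : Fin n → k) (i : Fin n) (σ : Finset (Fin n)) :
    ph a x i σ * ph a x i (fl σ i) = a i * (x (i - 1) * x i) := by
  have h1 := Am_self a i σ
  have h2 := kap_left hn x i σ
  have h3 := kap_right hn x (i - 1) σ
  rw [sub_add_cancel] at h3
  unfold ph
  rw [← h1, ← h2, ← h3]; ring

theorem ph_exch_succ (hn : 3 ≤ n) (a x : Fin n → k) (i : Fin n) (σ : Finset (Fin n)) :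
    ph a x i σ * ph a x (i + 1) (fl σ i) = ph a x (i + 1) σ * ph a x i (fl σ (i + 1)) := by
  have h2 := kap_left hn x i σ
  have h3 := kap_right hn x i σ
  unfold ph
  rw [add_sub_cancel_right, Am_fl a (ne1 hn i), Am_fl a (ne1 hn i).symm]
  have e1 : kap x (fl σ i) (i + 1) = kap x σ (i + 1) := by
    apply kap_fl x (ne1 hn i)
    intro h
    apply fin_two_ne hn
    rw [add_assoc] at h
    simpa using h
  have e2 : kap x (fl σ (i + 1)) (i - 1) = kap x σ (i - 1) := by
    apply kap_fl x (ne3 hn i).symm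
    rw [sub_add_cancel]
    exact (ne1 hn i).symm
  rw [e1, e2]
  linear_combination (Am a i σ * Am a (i+1) σ * kap x σ (i-1) * kap x σ (i+1)) * (h2 - h3)

theorem ph_exch (hn : 3 ≤ n) (a x : Fin n → k) (i j : Fin n) (σ : Finset (Fin n)) (h : i ≠ j) :
    ph a x i σ * ph a x j (fl σ i) = ph a x j σ * ph a x i (fl σ j) := by
  by_cases h1 : j = i + 1
  · subst h1; exact ph_exch_succ hn a x i σ
  by_cases h2 : i = j + 1
  · subst h2; exact (ph_exch_succ hn a x j σ).symm
  unfold ph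
  rw [Am_fl a h, Am_fl a (Ne.symm h), kap_fl x (b := j) (Ne.symm h) (Ne.symm h2),
    kap_fl x (b := i) h (Ne.symm h1), kap_fl x (b := j - 1) (j := i),
    kap_fl x (b := i - 1) (j := j)]
  · ring
  · intro e; exact h2 (by rw [← e, sub_add_cancel])
  · rw [sub_add_cancel]; exact h
  · intro e; exact h1 (by rw [← e, sub_add_cancel])
  · rw [sub_add_cancel]; exact Ne.symm h

def ff (a x : Fin n → k) : k := ∑ i, a i * (x (i - 1) * x i)

theorem opr_ph_sq (hn : 3 ≤ n) (a x : Fin n → k) (v : Finset (Fin n) → k) :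
    opr (ph a x) (opr (ph a x) v) = ff a x • v :=
  opr_sq _ _ (ph_diag hn a x) (ph_exch hn a x) v

theorem taylor_mulVec (hn : 3 ≤ n) (a : Fin n → k) (v : Finset (Fin n) → k) :
    (taylorMatrixAt (cycleEdges n) a).mulVec v = opr (ph a 0) v := by
  funext r
  rw [opr_apply]
  simp only [Matrix.mulVec, dotProduct, taylorMatrixAt, add_mul, Finset.sum_add_distrib,
    Finset.sum_mul]
  rw [Finset.sum_comm, Finset.sum_comm (γ := Finset (Fin n)) (s := Finset.univ)
    (f := fun (c : Finset (Fin n)) (i : Fin n) => (if r = insert i c ∧ HomEdge (cycleEdges n) c i then (edgeSign c i : k) * a i else 0) * v c),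
    ← Finset.sum_add_distrib]
  apply Finset.sum_congr rfl
  intro i _
  simp only [diffEdge_iff hn, homEdge_iff hn]
  have m1 := ne1 hn i
  have m2 := ne2 hn i
  rw [Finset.sum_eq_single (fl r i), Finset.sum_eq_single (fl r i)]
  · have hsg : (edgeSign (fl r i) i : k) = sg k i r := sg_fl_self (k := k) i r
    have hsg' : (edgeSign r i : k) = sg k i r := rfl
    simp only [mem_fl_self, mem_fl_ne r m1, mem_fl_ne r m2, hsg, hsg', ph, Am, kap,
      sub_add_cancel, Pi.zero_apply]
    by_cases hi : i ∈ r
    · have e : r = insert i (fl r i) := by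
        ext j; rw [Finset.mem_insert, mem_fl]
        by_cases hj : j = i
        · subst hj; simp [hi]
        · simp [hj]
      simp only [← e]
      by_cases h1 : i - 1 ∈ r <;> by_cases h2 : i + 1 ∈ r <;> simp [hi, h1, h2]
    · have e : fl r i = insert i r := by
        ext j; rw [Finset.mem_insert, mem_fl]
        by_cases hj : j = i
        · subst hj; simp [hi]
        · simp [hj]
      simp only [e]
      by_cases h1 : i - 1 ∈ r <;> by_cases h2 : i + 1 ∈ r <;> simp [hi, h1, h2]
  · intro c _ hc
    rw [if_neg, zero_mul]
    rintro ⟨rfl, h, -⟩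
    apply hc
    ext j; rw [mem_fl, Finset.mem_insert]
    by_cases hj : j = i
    · subst hj; simp [h]
    · simp [hj]
  · simp
  · intro c _ hc
    rw [if_neg, zero_mul]
    rintro ⟨rfl, h, -⟩
    apply hc
    ext j; rw [mem_fl, Finset.mem_insert]
    by_cases hj : j = i
    · subst hj; simp [h]
    · simp [hj]
  · simp

theorem ff_zero (a : Fin n → k) : ff a 0 = 0 := by simp [ff]

theorem taylor_sq (hn : 3 ≤ n) (a : Fin n → k) :
    taylorMatrixAt (cycleEdges n) a * taylorMatrixAt (cycleEdges n) a = 0 := by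
  apply Matrix.mulVec_injective
  funext v
  rw [← Matrix.mulVec_mulVec, taylor_mulVec hn, taylor_mulVec hn, opr_ph_sq hn, ff_zero]
  simp

end cyc
def MM : Matrix Bool Bool ℤ := Matrix.of fun p q => if p = true ∧ q = false then -1 else 1

theorem path_sum (m : ℕ) (h : Bool → ℤ) (a : Bool) :
    ∑ s : Fin m → Bool, (∏ i : Fin m, MM ((Fin.cons a s : Fin (m+1) → Bool) i.castSucc)
      ((Fin.cons a s : Fin (m+1) → Bool) i.succ)) * h ((Fin.cons a s : Fin (m+1) → Bool) (Fin.last m))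
      = ((MM ^ m).mulVec h) a := by
  induction m generalizing a with
  | zero => simp
  | succ m ih =>
    rw [← (Fin.consEquiv (fun _ : Fin (m+1) => Bool)).sum_comp, Fintype.sum_prod_type, pow_succ',
      ← Matrix.mulVec_mulVec]
    conv_rhs => rw [Matrix.mulVec, dotProduct]
    apply Finset.sum_congr rfl
    intro b _
    rw [← ih b, Finset.mul_sum]
    apply Finset.sum_congr rfl
    intro s _
    rw [Fin.prod_univ_succ]
    simp only [Fin.consEquiv_apply, Fin.castSucc_zero, Fin.cons_zero, Fin.cons_succ,
      ← Fin.succ_castSucc, ← Fin.succ_last, mul_assoc]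

theorem cyc_sum (m : ℕ) :
    ∑ s : Fin (m+1) → Bool, (∏ i : Fin (m+1), MM (s i) (s (i + 1))) = (MM ^ (m+1)).trace := by
  rw [← (Fin.consEquiv (fun _ : Fin (m+1) => Bool)).sum_comp, Fintype.sum_prod_type]
  rw [Matrix.trace]
  apply Finset.sum_congr rfl
  intro a _
  have := path_sum m (fun b => MM b a) a
  rw [Matrix.diag_apply, pow_succ, Matrix.mul_apply]
  rw [Matrix.mulVec, dotProduct] at this
  rw [← this]
  apply Finset.sum_congr rfl
  intro s _
  rw [Fin.prod_univ_castSucc]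
  simp only [Fin.consEquiv_apply, Fin.coeSucc_eq_succ, Fin.last_add_one, Fin.cons_zero]

theorem MM_two : MM ^ 2 = Matrix.of fun p q => if p = q then 0 else if p = true then -2 else 2 := by
  ext p q
  rw [pow_two, Matrix.mul_apply]
  cases p <;> cases q <;> simp [MM]

theorem MM_four : MM ^ 4 = (-4 : ℤ) • (1 : Matrix Bool Bool ℤ) := by
  rw [show 4 = 2 * 2 from rfl, pow_mul, pow_two, MM_two]
  ext p q
  rw [Matrix.mul_apply]
  cases p <;> cases q <;> simp

theorem MM_trace (n : ℕ) (hn : n % 4 ≠ 2) : (MM ^ n).trace ≠ 0 := by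
  have h : MM ^ n = ((-4 : ℤ) ^ (n / 4)) • MM ^ (n % 4) := by
    conv_lhs => rw [← Nat.div_add_mod n 4, pow_add, pow_mul, MM_four, smul_pow, one_pow]
    simp
  rw [h, Matrix.trace_smul, smul_ne_zero_iff]
  refine ⟨by positivity, ?_⟩
  have : n % 4 = 0 ∨ n % 4 = 1 ∨ n % 4 = 3 := by omega
  rcases this with h | h | h <;> rw [h]
  · simp [Matrix.trace]
  · simp [Matrix.trace, MM]
  · rw [pow_succ, MM_two]; simp [Matrix.trace, Matrix.mul_apply, MM]

section euler
variable {n : ℕ} [NeZero n] {k : Type*} [Field k]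

def eps (σ : Finset (Fin n)) : ℤ := ∏ b : Fin n, if b ∈ σ ∧ b + 1 ∉ σ then -1 else 1

theorem eps_sum (hn : n % 4 ≠ 2) : ∑ σ : Finset (Fin n), eps σ ≠ 0 := by
  obtain ⟨m, rfl⟩ : ∃ m, n = m + 1 := ⟨n - 1, by have := NeZero.pos n; omega⟩
  have h := cyc_sum m
  have h2 : ∑ σ : Finset (Fin (m+1)), eps σ =
      ∑ s : Fin (m+1) → Bool, (∏ i : Fin (m+1), MM (s i) (s (i + 1))) := by
    symm
    apply Finset.sum_bij (fun s _ => Finset.univ.filter (fun i => s i = true))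
    · intro s _; simp
    · intro s _ s' _ h
      funext i
      have := Finset.ext_iff.mp h i
      simp only [Finset.mem_filter, Finset.mem_univ, true_and] at this
      exact Bool.eq_iff_iff.mpr this
    · intro σ _
      exact ⟨fun i => decide (i ∈ σ), Finset.mem_univ _, by ext; simp⟩
    · intro s _
      unfold eps
      apply Finset.prod_congr rfl
      intro i _
      simp [MM]
  rw [h2, h]
  exact MM_trace _ hn

theorem eps_pm (σ : Finset (Fin n)) : eps σ = 1 ∨ eps σ = -1 := by
  unfold eps
  apply Finset.prod_induction _ (fun x : ℤ => x = 1 ∨ x = -1)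
  · rintro a b (rfl | rfl) (rfl | rfl) <;> simp
  · simp
  · intro b _; split_ifs <;> simp

theorem eps_fl (hn : 3 ≤ n) (a : Fin n → k) (i : Fin n) (r : Finset (Fin n))
    (h : ph a 0 i r ≠ 0) : eps (fl r i) = - eps r := by
  have m1 := ne1 hn i
  have m2 := ne2 hn i
  unfold eps
  have hi : i - 1 ∈ Finset.univ.erase i := by simp [m2]
  rw [← Finset.mul_prod_erase _ _ (Finset.mem_univ i), ← Finset.mul_prod_erase _ _ hi,
    ← Finset.mul_prod_erase (Finset.univ) _ (Finset.mem_univ i),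
    ← Finset.mul_prod_erase (Finset.univ.erase i) _ hi]
  have e : ∀ b ∈ (Finset.univ.erase i).erase (i - 1),
      (if b ∈ fl r i ∧ b + 1 ∉ fl r i then (-1 : ℤ) else 1) = if b ∈ r ∧ b + 1 ∉ r then -1 else 1 := by
    intro b hb
    simp only [Finset.mem_erase, Finset.mem_univ, and_true] at hb
    have hb2 : b + 1 ≠ i := fun e => hb.1 (by rw [← e]; simp)
    simp only [mem_fl_ne r hb.2, mem_fl_ne r hb2]
  rw [Finset.prod_congr rfl e]
  simp only [mem_fl_self, sub_add_cancel, mem_fl_ne r m1, mem_fl_ne r m2]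
  simp only [ph, kap, sub_add_cancel, Pi.zero_apply] at h
  by_cases hi : i ∈ r <;> by_cases h1 : i - 1 ∈ r <;> by_cases h2 : i + 1 ∈ r <;>
    simp [hi, h1, h2] at h ⊢

theorem taylor_ne_zero (hn : 3 ≤ n) (a : Fin n → k) (r c : Finset (Fin n))
    (h : taylorMatrixAt (cycleEdges n) a r c ≠ 0) : ∃ i, fl r i = c ∧ ph a 0 i r ≠ 0 := by
  have h1 := congrFun (taylor_mulVec hn a (Pi.single c 1)) r
  rw [Matrix.mulVec_single_one, opr_apply] at h1
  change taylorMatrixAt (cycleEdges n) a r c = _ at h1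
  rw [h1] at h
  obtain ⟨i, -, hi⟩ := Finset.exists_ne_zero_of_sum_ne_zero h
  refine ⟨i, ?_, ?_⟩
  · by_contra hc
    rw [Pi.single_eq_of_ne hc, mul_zero] at hi
    exact hi rfl
  · intro h0
    rw [h0] at hi; simp at hi

theorem card_fs : Fintype.card (Finset (Fin n)) = 2 * 2 ^ (n - 1) := by
  rw [Fintype.card_finset, Fintype.card_fin, ← pow_succ', Nat.sub_add_cancel (NeZero.pos n)]

theorem euler_case (hn : 3 ≤ n) (h4 : n % 4 ≠ 2) (a : Fin n → k) :
    a ∈ supportVariety k (cycleEdges n) := by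
  refine (minors_iff _ _).mpr ?_
  have key : ∀ r c, taylorMatrixAt (cycleEdges n) a r c ≠ 0 → eps r = - eps c := by
    intro r c h
    obtain ⟨i, rfl, hi⟩ := taylor_ne_zero hn a r c h
    rw [eps_fl hn a i r hi]; simp
  have r1 := rank_le_half _ (taylor_sq hn a) (fun σ => eps σ = 1) (by
    intro r c h
    have := key r c h
    rcases eps_pm r with h1 | h1 <;> rcases eps_pm c with h2 | h2 <;> simp_all)
  have r2 := rank_le_half _ (taylor_sq hn a) (fun σ => ¬ eps σ = 1) (by
    intro r c h
    have := key r c h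
    rcases eps_pm r with h1 | h1 <;> rcases eps_pm c with h2 | h2 <;> simp_all)
  have hs := eps_sum (n := n) h4
  have hc := Fintype.card_subtype_compl (fun σ : Finset (Fin n) => eps σ = 1)
  have hle := Fintype.card_subtype_le (fun σ : Finset (Fin n) => eps σ = 1)
  rw [card_fs] at hc hle
  have hs2 : ∑ σ : Finset (Fin n), eps σ =
      (Fintype.card {σ : Finset (Fin n) // eps σ = 1} : ℤ)
        - (Fintype.card {σ : Finset (Fin n) // ¬ eps σ = 1} : ℤ) := by
    rw [← Fintype.sum_subtype_add_sum_subtype (fun σ : Finset (Fin n) => eps σ = 1)]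
    have e1 : ∑ i : {σ : Finset (Fin n) // eps σ = 1}, eps i.1
        = ∑ i : {σ : Finset (Fin n) // eps σ = 1}, 1 :=
      Finset.sum_congr rfl (fun i _ => i.2)
    have e2 : ∑ i : {σ : Finset (Fin n) // ¬ eps σ = 1}, eps i.1
        = ∑ i : {σ : Finset (Fin n) // ¬ eps σ = 1}, (-1) :=
      Finset.sum_congr rfl (fun i _ => (eps_pm i.1).resolve_left i.2)
    rw [e1, e2]
    simp [sub_eq_add_neg]
  rw [hs2] at hs
  simp only [← Nat.card_eq_fintype_card] at r1 r2 hc hle hs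
  omega

theorem mem_support_iff (hn : 3 ≤ n) (a : Fin n → k) :
    a ∈ supportVariety k (cycleEdges n) ↔
      ∃ v, opr (ph a 0) v = 0 ∧ ∀ u, opr (ph a 0) u ≠ v := by
  refine (minors_iff _ _).trans ?_
  rw [rank_lt_iff _ _ card_fs (taylor_sq hn a)]
  simp only [taylor_mulVec hn]

end euler
section absalg
variable {k V : Type*} [Field k] [AddCommGroup V] [Module k V]

/-- Abstract Clifford-type exactness argument. -/
theorem clifford_abs (K I : Submodule k V) (N : ℕ) (p m : ℕ → V →ₗ[k] V)
    (pK : ∀ r v, v ∈ K → p r v ∈ K) (mK : ∀ r v, v ∈ K → m r v ∈ K)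
    (pI : ∀ r v, v ∈ I → p r v ∈ I) (mI : ∀ r v, v ∈ I → m r v ∈ I)
    (mm : ∀ r < N, ∀ v ∈ K, m r (m r v) ∈ I)
    (ms : ∀ r < N, ∀ s < N, ∀ v ∈ K, m r (m s v) + m s (m r v) ∈ I)
    (mp : ∀ r < N, ∀ s < N, r ≠ s → ∀ v ∈ K, m r (p s v) + p s (m r v) ∈ I)
    (mp1 : ∀ r < N, ∀ v ∈ K, m r (p r v) + p r (m r v) - v ∈ I)
    (nil : ∀ w : ℕ → V, (∀ r < N, w (r + 1) = p r (w r)) → w N = 0) :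
    K ≤ I := by
  intro v0 hv0
  by_contra hv0I
  have step1 : ∀ r ≤ N, ∃ v ∈ K, v ∉ I ∧ ∀ s < r, m s v ∈ I := by
    intro r
    induction r with
    | zero => intro _; exact ⟨v0, hv0, hv0I, by simp⟩
    | succ r ih =>
      intro hr
      obtain ⟨v, hvK, hvI, hs⟩ := ih (by omega)
      by_cases h : m r v ∈ I
      · refine ⟨v, hvK, hvI, fun s hs' => ?_⟩
        rcases Nat.lt_succ_iff_lt_or_eq.mp hs' with h1 | rfl
        · exact hs s h1
        · exact h
      · refine ⟨m r v, mK r v hvK, h, fun s hs' => ?_⟩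
        rcases Nat.lt_succ_iff_lt_or_eq.mp hs' with h1 | rfl
        · have := ms s (by omega) r (by omega) v hvK
          exact (I.add_mem_iff_left (mI r _ (hs s h1))).mp this
        · exact mm s (by omega) v hvK
  obtain ⟨v, hvK, hvI, hs⟩ := step1 N le_rfl
  let w : ℕ → V := fun r => Nat.rec v (fun r w => p r w) r
  have hw : ∀ r, w (r + 1) = p r (w r) := fun r => rfl
  have step2 : ∀ r ≤ N, w r ∈ K ∧ w r ∉ I ∧ ∀ s < N, r ≤ s → m s (w r) ∈ I := by
    intro r
    induction r with
    | zero => intro _; exact ⟨hvK, hvI, fun s h _ => hs s h⟩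
    | succ r ih =>
      intro hr
      obtain ⟨h1, h2, h3⟩ := ih (by omega)
      rw [hw]
      refine ⟨pK r _ h1, fun h => h2 ?_, fun s hs hrs => ?_⟩
      · have e := mp1 r (by omega) _ h1
        have e2 := I.add_mem (mI r _ h) (pI r _ (h3 r (by omega) le_rfl))
        have := I.sub_mem e2 e
        simpa using this
      · have e := mp s hs r (by omega) (by omega) _ h1
        exact (I.add_mem_iff_left (pI r _ (h3 s hs (by omega)))).mp e
  have := (step2 N le_rfl).2.1
  rw [nil w (fun r _ => hw r)] at this
  exact this I.zero_mem

theorem poly4 [Infinite k] (c0 c1 c2 c3 c4 : k)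
    (h : ∀ s : k, c0 + s * c1 + s ^ 2 * c2 + s ^ 3 * c3 + s ^ 4 * c4 = 0) :
    c0 = 0 ∧ c1 = 0 ∧ c2 = 0 := by
  open Polynomial in
  have hp : (C c0 + X * C c1 + X ^ 2 * C c2 + X ^ 3 * C c3 + X ^ 4 * C c4 : k[X]) = 0 := by
    apply Polynomial.funext
    intro s
    simp only [Polynomial.X_mul_C, Polynomial.X_pow_mul_C, Polynomial.eval_add, Polynomial.eval_mul, Polynomial.eval_C, Polynomial.eval_X, Polynomial.eval_pow, Polynomial.eval_zero]
    linear_combination h s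
  refine ⟨?_, ?_, ?_⟩
  · simpa [Polynomial.coeff_X, Polynomial.coeff_X_pow, Polynomial.coeff_one] using congrArg (fun q => Polynomial.coeff q 0) hp
  · simpa [Polynomial.coeff_X, Polynomial.coeff_X_pow, Polynomial.coeff_one] using congrArg (fun q => Polynomial.coeff q 1) hp
  · simpa [Polynomial.coeff_X, Polynomial.coeff_X_pow, Polynomial.coeff_one] using congrArg (fun q => Polynomial.coeff q 2) hp

end absalg

section psi
variable {n : ℕ} [NeZero n] {k : Type*} [Field k]

def k0 (k : Type*) [Field k] (σ : Finset (Fin n)) (b : Fin n) : k :=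
  if (b ∈ σ ↔ b + 1 ∈ σ) then 0 else 1
def k1 (x : Fin n → k) (σ : Finset (Fin n)) (b : Fin n) : k :=
  if (b ∈ σ ↔ b + 1 ∈ σ) then x b else 0

theorem kap_dec (x : Fin n → k) (s : k) (σ : Finset (Fin n)) (b : Fin n) :
    kap (s • x) σ b = k0 k σ b + s * k1 x σ b := by
  unfold kap k0 k1; split_ifs <;> simp

def ph1 (a x : Fin n → k) (i : Fin n) (σ : Finset (Fin n)) : k :=
  Am a i σ * (k0 k σ (i - 1) * k1 x σ i + k1 x σ (i - 1) * k0 k σ i)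
def ph2 (a x : Fin n → k) (i : Fin n) (σ : Finset (Fin n)) : k :=
  Am a i σ * (k1 x σ (i - 1) * k1 x σ i)

theorem opr_dec (a x : Fin n → k) (s : k) (v : Finset (Fin n) → k) :
    opr (ph a (s • x)) v = opr (ph a 0) v + s • opr (ph1 a x) v + s ^ 2 • opr (ph2 a x) v := by
  have h0 : ∀ i σ, ph a 0 i σ = Am a i σ * (k0 k σ (i - 1) * k0 k σ i) := by
    intro i σ
    have := fun b => kap_dec (0 : Fin n → k) 0 σ b
    simp only [zero_smul, zero_mul, add_zero] at this
    rw [ph, this, this]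
  funext σ
  simp only [opr_apply, Pi.add_apply, Pi.smul_apply, smul_eq_mul, Finset.mul_sum,
    ← Finset.sum_add_distrib]
  apply Finset.sum_congr rfl
  intro i _
  rw [h0, ph, kap_dec, kap_dec, ph1, ph2]; ring

theorem ff_smul (a x : Fin n → k) (s : k) : ff a (s • x) = s ^ 2 * ff a x := by
  simp only [ff, Finset.mul_sum, Pi.smul_apply, smul_eq_mul]
  apply Finset.sum_congr rfl; intro i _; ring

theorem psi_rel [Infinite k] (hn : 3 ≤ n) (a x : Fin n → k) (v : Finset (Fin n) → k) :
    opr (ph a 0) (opr (ph1 a x) v) + opr (ph1 a x) (opr (ph a 0) v) = 0 ∧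
    opr (ph1 a x) (opr (ph1 a x) v) + opr (ph a 0) (opr (ph2 a x) v)
      + opr (ph2 a x) (opr (ph a 0) v) = ff a x • v := by
  set D := opr (ph a 0)
  set P := opr (ph1 a x)
  set E := opr (ph2 a x)
  have key : ∀ σ, (D (P v) + P (D v)) σ = 0 ∧
      (P (P v) + D (E v) + E (D v) - ff a x • v) σ = 0 := by
    intro σ
    have := poly4 (D (D v) σ) ((D (P v) + P (D v)) σ)
      ((P (P v) + D (E v) + E (D v) - ff a x • v) σ)
      ((P (E v) + E (P v)) σ) (E (E v) σ) (by
        intro s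
        have h := congrFun (opr_ph_sq hn a (s • x) v) σ
        rw [opr_dec, opr_dec, ff_smul] at h
        simp only [map_add, map_smul, Pi.add_apply, Pi.smul_apply, smul_eq_mul, Pi.sub_apply] at h ⊢
        linear_combination h)
    exact ⟨this.2.1, this.2.2⟩
  constructor
  · funext σ; exact (key σ).1
  · rw [← sub_eq_zero]; funext σ; exact (key σ).2

theorem ph1_add (a x y : Fin n → k) (v : Finset (Fin n) → k) :
    opr (ph1 a (x + y)) v = opr (ph1 a x) v + opr (ph1 a y) v := by
  have hk : ∀ σ b, k1 (x + y) σ b = k1 x σ b + k1 y σ b := by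
    intro σ b; unfold k1; split_ifs <;> simp
  funext σ
  simp only [opr_apply, Pi.add_apply, ← Finset.sum_add_distrib]
  apply Finset.sum_congr rfl
  intro i _
  rw [ph1, ph1, ph1, hk, hk]; ring

theorem psi_ker [Infinite k] (hn : 3 ≤ n) (a x : Fin n → k) (v : Finset (Fin n) → k)
    (hv : v ∈ LinearMap.ker (opr (ph a 0))) :
    opr (ph1 a x) v ∈ LinearMap.ker (opr (ph a 0)) := by
  have := (psi_rel hn a x v).1
  rw [LinearMap.mem_ker] at hv ⊢
  simpa [hv] using this

theorem psi_range [Infinite k] (hn : 3 ≤ n) (a x : Fin n → k) (v : Finset (Fin n) → k)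
    (hv : v ∈ LinearMap.range (opr (ph a 0))) :
    opr (ph1 a x) v ∈ LinearMap.range (opr (ph a 0)) := by
  obtain ⟨u, rfl⟩ := hv
  have := (psi_rel hn a x u).1
  refine ⟨- opr (ph1 a x) u, ?_⟩
  rw [map_neg]
  exact neg_eq_of_add_eq_zero_right this

theorem psi_sq_mem [Infinite k] (hn : 3 ≤ n) (a x : Fin n → k) (v : Finset (Fin n) → k)
    (hv : v ∈ LinearMap.ker (opr (ph a 0))) :
    opr (ph1 a x) (opr (ph1 a x) v) - ff a x • v ∈ LinearMap.range (opr (ph a 0)) := by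
  have := (psi_rel hn a x v).2
  rw [LinearMap.mem_ker] at hv
  rw [hv, map_zero, add_zero] at this
  refine ⟨- opr (ph2 a x) v, ?_⟩
  rw [map_neg, ← this]; abel

theorem psi_anti [Infinite k] (hn : 3 ≤ n) (a x y : Fin n → k) (v : Finset (Fin n) → k)
    (hv : v ∈ LinearMap.ker (opr (ph a 0))) :
    opr (ph1 a x) (opr (ph1 a y) v) + opr (ph1 a y) (opr (ph1 a x) v)
      - (ff a (x + y) - ff a x - ff a y) • v ∈ LinearMap.range (opr (ph a 0)) := by
  have h1 := psi_sq_mem hn a (x + y) v hv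
  have h2 := psi_sq_mem hn a x v hv
  have h3 := psi_sq_mem hn a y v hv
  have := Submodule.sub_mem _ (Submodule.sub_mem _ h1 h2) h3
  convert this using 1
  rw [ph1_add, ph1_add, map_add, map_add, sub_smul, sub_smul]
  abel

end psi
section charge
variable {n : ℕ} [NeZero n]

def par (b : Fin n) : ℤ := (-1) ^ b.val

theorem fin_val_succ (b : Fin n) : ((b + 1 : Fin n).val = b.val + 1 ∧ b.val + 1 < n) ∨
    ((b + 1 : Fin n).val = 0 ∧ b.val + 1 = n) := by
  have hb := b.isLt
  rw [Fin.val_add, Fin.val_one', Nat.add_mod_mod]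
  rcases Nat.lt_or_ge (b.val + 1) n with h | h
  · left; exact ⟨Nat.mod_eq_of_lt h, h⟩
  · right
    have : b.val + 1 = n := by omega
    rw [this]; simp

theorem par_succ (he : n % 2 = 0) (b : Fin n) : par (b + 1) = - par b := by
  unfold par
  rcases fin_val_succ b with ⟨h, _⟩ | ⟨h, h'⟩
  · rw [h, pow_succ]; ring
  · rw [h]
    have : Odd b.val := by rw [Nat.odd_iff]; omega
    rw [this.neg_one_pow]; simp

theorem par_pm (b : Fin n) : par b = 1 ∨ par b = -1 := neg_one_pow_eq_or _ _

def wall (σ : Finset (Fin n)) (b : Fin n) : ℤ := if (b ∈ σ ↔ b + 1 ∈ σ) then 0 else 1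

def chg (σ : Finset (Fin n)) : ℤ := ∑ b, par b * wall σ b

theorem chg_even (σ : Finset (Fin n)) : (2 : ℤ) ∣ chg σ := by
  apply (ZMod.intCast_zmod_eq_zero_iff_dvd _ 2).mp
  have h : ∀ b : Fin n, ((par b * wall σ b : ℤ) : ZMod 2) =
      (if b ∈ σ then 1 else 0) + (if b + 1 ∈ σ then 1 else 0) := by
    intro b
    have h1 : ((par b : ℤ) : ZMod 2) = 1 := by
      rcases par_pm b with h | h <;> rw [h] <;> decide
    rw [Int.cast_mul, h1, wall]
    by_cases h1 : b ∈ σ <;> by_cases h2 : b + 1 ∈ σ <;> simp [h1, h2] <;> decide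
  rw [chg, Int.cast_sum, Finset.sum_congr rfl (fun b _ => h b), Finset.sum_add_distrib]
  have e := Equiv.sum_comp (Equiv.addRight (1 : Fin n)) (fun b => if b ∈ σ then (1 : ZMod 2) else 0)
  simp only [Equiv.coe_addRight] at e
  refine (congrArg₂ (· + ·) rfl (Eq.trans (by congr) e)).trans ?_
  exact CharTwo.add_self_eq_zero _

theorem chg_abs (he : n % 2 = 0) (σ : Finset (Fin n)) : |2 * chg σ| ≤ n := by
  have hp : ∑ b : Fin n, par b = 0 := by
    have := Equiv.sum_comp (Equiv.addRight (1 : Fin n)) (fun b => par b)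
    simp only [Equiv.coe_addRight, par_succ he, Finset.sum_neg_distrib] at this
    linarith
  have : 2 * chg σ = ∑ b : Fin n, par b * (2 * wall σ b - 1) := by
    simp only [mul_sub, Finset.sum_sub_distrib, mul_one, hp, sub_zero, chg, Finset.mul_sum]
    apply Finset.sum_congr rfl; intro b _; ring
  rw [this]
  refine (Finset.abs_sum_le_sum_abs _ _).trans ?_
  refine (Finset.sum_le_card_nsmul _ _ 1 ?_).trans (by simp)
  intro b _
  unfold wall
  rcases par_pm b with h | h <;> rw [h] <;> split_ifs <;> norm_num

theorem wall_fl {b j : Fin n} (h : b ≠ j) (h' : b + 1 ≠ j) (σ : Finset (Fin n)) :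
    wall (fl σ j) b = wall σ b := by
  unfold wall; simp only [mem_fl_ne σ h, mem_fl_ne σ h']

theorem wall_left (hn : 3 ≤ n) (b : Fin n) (σ : Finset (Fin n)) :
    wall (fl σ b) b = 1 - wall σ b := by
  unfold wall; simp only [mem_fl_self, mem_fl_ne σ (ne1 hn b)]
  by_cases h : b ∈ σ <;> by_cases h' : b + 1 ∈ σ <;> simp [h, h']

theorem wall_right (hn : 3 ≤ n) (b : Fin n) (σ : Finset (Fin n)) :
    wall (fl σ (b + 1)) b = 1 - wall σ b := by
  unfold wall; simp only [mem_fl_self, mem_fl_ne σ (ne1 hn b).symm]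
  by_cases h : b ∈ σ <;> by_cases h' : b + 1 ∈ σ <;> simp [h, h']

theorem chg_fl (hn : 3 ≤ n) (he : n % 2 = 0) (i : Fin n) (σ : Finset (Fin n)) :
    chg (fl σ i) = chg σ + par i * (1 - 2 * wall σ i) - par i * (1 - 2 * wall σ (i - 1)) := by
  have hd : chg (fl σ i) - chg σ = ∑ b, par b * (wall (fl σ i) b - wall σ b) := by
    simp only [chg, mul_sub, Finset.sum_sub_distrib]
  have h2 : ∑ b, par b * (wall (fl σ i) b - wall σ b) =
      ∑ b ∈ {i, i - 1}, par b * (wall (fl σ i) b - wall σ b) := by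
    symm
    apply Finset.sum_subset (Finset.subset_univ _)
    intro b _ hb
    simp only [Finset.mem_insert, Finset.mem_singleton, not_or] at hb
    rw [wall_fl hb.1, sub_self, mul_zero]
    intro h; exact hb.2 (by rw [← h]; simp)
  rw [Finset.sum_pair (ne2 hn i).symm, wall_left hn] at h2
  have h3 := wall_right hn (i - 1) σ
  have h4 := par_succ he (i - 1)
  rw [sub_add_cancel] at h3 h4
  rw [h3] at h2
  rw [h4] at h2 ⊢
  linarith

variable {k : Type*} [Field k]

theorem psi_lower (hn : 3 ≤ n) (he : n % 2 = 0) (a : Fin n → k) (b : Fin n) (hb : par b = 1)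
    (c : ℤ) (v : Finset (Fin n) → k) (hv : ∀ σ, v σ ≠ 0 → chg σ ≤ c) :
    ∀ σ, opr (ph1 a (Pi.single b 1)) v σ ≠ 0 → chg σ ≤ c - 2 := by
  intro σ h
  rw [opr_apply] at h
  obtain ⟨i, -, hi⟩ := Finset.exists_ne_zero_of_sum_ne_zero h
  have hvi := hv (fl σ i) (right_ne_zero_of_mul hi)
  have hph := right_ne_zero_of_mul (left_ne_zero_of_mul hi)
  have hph' := right_ne_zero_of_mul hph
  rw [chg_fl hn he] at hvi
  have h4 := par_succ he (i - 1)
  rw [sub_add_cancel] at h4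
  by_cases h1 : k0 k σ (i - 1) * k1 (Pi.single b 1) σ i = 0
  · rw [h1, zero_add] at hph'
    have q1 := left_ne_zero_of_mul hph'
    have q2 := right_ne_zero_of_mul hph'
    have w1 : wall σ (i - 1) = 0 := by
      unfold k1 at q1; unfold wall
      split_ifs at q1 ⊢ <;> simp_all
    have w2 : wall σ i = 1 := by
      unfold k0 at q2; unfold wall
      split_ifs at q2 ⊢ <;> simp_all
    have e : i - 1 = b := by
      by_contra hne
      apply q1; unfold k1; simp [Pi.single_eq_of_ne hne]
    rw [e, hb] at h4
    rw [w1, w2, h4] at hvi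
    linarith
  · have q1 := left_ne_zero_of_mul h1
    have q2 := right_ne_zero_of_mul h1
    have w1 : wall σ (i - 1) = 1 := by
      unfold k0 at q1; unfold wall
      split_ifs at q1 ⊢ <;> simp_all
    have w2 : wall σ i = 0 := by
      unfold k1 at q2; unfold wall
      split_ifs at q2 ⊢ <;> simp_all
    have e : i = b := by
      by_contra hne
      apply q2; unfold k1; simp [Pi.single_eq_of_ne hne]
    rw [w1, w2, e, hb] at hvi
    linarith

theorem psi_nil (hn : 3 ≤ n) (h4 : n % 4 = 2) (a : Fin n → k) (b : ℕ → Fin n)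
    (hb : ∀ r, par (b r) = 1) (w : ℕ → Finset (Fin n) → k)
    (hw : ∀ r < n / 2, w (r + 1) = opr (ph1 a (Pi.single (b r) 1)) (w r)) :
    w (n / 2) = 0 := by
  have he : n % 2 = 0 := by omega
  have key : ∀ r ≤ n / 2, ∀ σ, w r σ ≠ 0 → chg σ ≤ (n / 2 : ℕ) - 1 - 2 * (r : ℤ) := by
    intro r
    induction r with
    | zero =>
      intro _ σ _
      have h1 := chg_abs he σ
      obtain ⟨c, hc⟩ := chg_even σ
      have := (abs_le.mp h1).2
      omega
    | succ r ih =>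
      intro hr σ
      rw [hw r (by omega)]
      intro h
      have := psi_lower hn he a (b r) (hb r) _ _ (ih (by omega)) σ h
      omega
  funext σ
  by_contra h
  have h2 := key _ le_rfl σ h
  have h1 := chg_abs he σ
  have := (abs_le.mp h1).1
  omega

end charge
section lam
variable {k : Type*} [Field k]

/-- product of `a` along steps of two starting at `c`. -/
def FF (N : ℕ) (a : ℕ → k) (c : ℕ) : k := ∏ t ∈ Finset.range N, a (c + 2 * t)

theorem FF_two {N : ℕ} (a : ℕ → k) (ha : ∀ m, a (m + 2 * N) = a m) (c : ℕ) :
    FF N a (c + 2) = FF N a c := by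
  have hs : ∀ t, c + 2 + 2 * t = c + 2 * (t + 1) := fun t => by ring
  rcases N with _ | N
  · simp [FF]
  · unfold FF
    rw [Finset.prod_range_succ, Finset.prod_range_succ']
    simp only [hs, ha, mul_zero, add_zero]

theorem FF_const {N : ℕ} (a : ℕ → k) (ha : ∀ m, a (m + 2 * N) = a m) (c : ℕ) :
    FF N a c + FF N a (c + 1) = FF N a 0 + FF N a 1 := by
  induction c with
  | zero => rfl
  | succ c ih => rw [FF_two a ha, ← ih, add_comm]

theorem lam_inj {N : ℕ} (hN : Odd N) (a y : ℕ → k) (ha : ∀ m, a (m + 2 * N) = a m)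
    (hy : ∀ m, y (m + 2 * N) = y m) (h : ∀ m, a (m + 2) * y (m + 2) = - (a (m + 1) * y m))
    (hP : FF N a 0 + FF N a 1 ≠ 0) (m : ℕ) : y m = 0 := by
  have key : ∀ M, (∏ t ∈ Finset.range M, a (m + 2 + 2 * t)) * y (m + 2 * M)
      = (-1) ^ M * (∏ t ∈ Finset.range M, a (m + 1 + 2 * t)) * y m := by
    intro M
    induction M with
    | zero => simp
    | succ M ih =>
      rw [Finset.prod_range_succ, Finset.prod_range_succ]
      have h1 := h (m + 2 * M)
      have e1 : m + 2 + 2 * M = m + 2 * M + 2 := by ring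
      have e2 : m + 2 * (M + 1) = m + 2 * M + 2 := by ring
      have e3 : m + 1 + 2 * M = m + 2 * M + 1 := by ring
      rw [e1, e2, e3, pow_succ]
      linear_combination (∏ t ∈ Finset.range M, a (m + 2 + 2 * t)) * h1
        - a (m + 2 * M + 1) * ih
  have k1 := key N
  rw [hy, hN.neg_one_pow] at k1
  have k2 : (FF N a (m + 1) + FF N a (m + 1 + 1)) * y m = 0 := by
    unfold FF
    have : m + 1 + 1 = m + 2 := rfl
    rw [this]
    linear_combination k1
  rw [FF_const a ha] at k2
  exact (mul_eq_zero.mp k2).resolve_left hP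

theorem FF_fin {n : ℕ} [NeZero n] (he : n % 2 = 0) (a : Fin n → k) (e : ℕ) (hb : e < 2) :
    FF (n / 2) (fun m => a (Fin.ofNat n m)) e
      = ∏ i ∈ Finset.univ.filter (fun i : Fin n => i.val % 2 = e), a i := by
  unfold FF
  have hn := NeZero.pos n
  apply Finset.prod_bij (fun t _ => Fin.ofNat n (e + 2 * t))
  · intro t ht
    rw [Finset.mem_range] at ht
    simp only [Finset.mem_filter, Finset.mem_univ, true_and, Fin.val_ofNat]
    rw [Nat.mod_eq_of_lt (a := e + 2 * t) (b := n) (by omega)]; omega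
  · intro t ht s hs h
    rw [Finset.mem_range] at ht hs
    have := congrArg Fin.val h
    simp only [Fin.val_ofNat] at this
    rw [Nat.mod_eq_of_lt (by omega), Nat.mod_eq_of_lt (by omega)] at this
    omega
  · intro i hi
    simp only [Finset.mem_filter, Finset.mem_univ, true_and] at hi
    have := i.isLt
    refine ⟨i.val / 2, by rw [Finset.mem_range]; omega, ?_⟩
    apply Fin.ext
    rw [Fin.val_ofNat, Nat.mod_eq_of_lt (by omega)]
    omega
  · intros; rfl

variable {n : ℕ} [NeZero n]

theorem ofNat_succ (m : ℕ) : Fin.ofNat n (m + 1) = Fin.ofNat n m + 1 := by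
  apply Fin.ext
  simp [Fin.val_add, Fin.val_one']

theorem ofNat_per (m : ℕ) : Fin.ofNat n (m + n) = Fin.ofNat n m := by
  apply Fin.ext; simp

theorem ofNat_val (i : Fin n) : Fin.ofNat n i.val = i := by
  apply Fin.ext; simp

def Lam (a : Fin n → k) : (Fin n → k) →ₗ[k] (Fin n → k) where
  toFun y b := a (b + 1) * y (b + 1) + a b * y (b - 1)
  map_add' u v := by funext b; simp only [Pi.add_apply]; ring
  map_smul' c v := by funext b; simp only [Pi.smul_apply, smul_eq_mul, RingHom.id_apply]; ring

theorem Lam_surj (h4 : n % 4 = 2) (a : Fin n → k)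
    (hP : (∏ i ∈ Finset.univ.filter (fun i : Fin n => i.val % 2 = 0), a i) +
          (∏ i ∈ Finset.univ.filter (fun i : Fin n => i.val % 2 = 1), a i) ≠ 0) :
    Function.Surjective (Lam a) := by
  rw [← LinearMap.injective_iff_surjective, ← LinearMap.ker_eq_bot, LinearMap.ker_eq_bot']
  intro y hy
  have e2 : 2 * (n / 2) = n := by omega
  rw [← FF_fin (by omega) a 0 (by omega), ← FF_fin (by omega) a 1 (by omega)] at hP
  funext i
  have := lam_inj (N := n / 2) (by rw [Nat.odd_iff]; omega) (fun m => a (Fin.ofNat n m))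
    (fun m => y (Fin.ofNat n m)) (by intro m; simp only [e2, ofNat_per])
    (by intro m; simp only [e2, ofNat_per]) (by
      intro m
      have := congrFun hy (Fin.ofNat n (m + 1))
      simp only [Lam, LinearMap.coe_mk, AddHom.coe_mk, Pi.zero_apply] at this
      rw [← ofNat_succ, ofNat_succ m, add_sub_cancel_right, ← ofNat_succ] at this
      exact eq_neg_of_add_eq_zero_left this) hP i.val
  rw [ofNat_val] at this
  exact this

theorem ff_polar_single (hn : 3 ≤ n) (a y : Fin n → k) (b : Fin n) :
    ff a (y + Pi.single b 1) - ff a y - ff a (Pi.single b 1) = Lam a y b := by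
  have h : ff a (y + Pi.single b 1) - ff a y - ff a (Pi.single b 1)
      = ∑ i, (a i * y i * (Pi.single b 1 : Fin n → k) (i - 1) + a i * y (i - 1) * (Pi.single b 1 : Fin n → k) i) := by
    simp only [ff, ← Finset.sum_sub_distrib, Pi.add_apply]
    apply Finset.sum_congr rfl; intro i _; ring
  rw [h, Finset.sum_add_distrib, Finset.sum_eq_single (b + 1), Finset.sum_eq_single b]
  · simp [Lam]
  · intro i _ hi; simp [Pi.single_eq_of_ne hi]
  · simp
  · intro i _ hi
    have : i - 1 ≠ b := fun h => hi (by rw [← h, sub_add_cancel])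
    simp [Pi.single_eq_of_ne this]
  · simp

theorem ff_odd (he : n % 2 = 0) (a y : Fin n → k) (hy : ∀ b, par b = 1 → y b = 0) :
    ff a y = 0 := by
  unfold ff
  apply Finset.sum_eq_zero
  intro i _
  have h4 := par_succ he (i - 1)
  rw [sub_add_cancel] at h4
  rcases par_pm i with h | h
  · rw [hy i h]; ring
  · rw [hy (i - 1) (by linarith)]; ring

theorem exact_case [Infinite k] (hn : 3 ≤ n) (h4 : n % 4 = 2) (a : Fin n → k)
    (hP : (∏ i ∈ Finset.univ.filter (fun i : Fin n => i.val % 2 = 0), a i) +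
          (∏ i ∈ Finset.univ.filter (fun i : Fin n => i.val % 2 = 1), a i) ≠ 0) :
    LinearMap.ker (opr (ph a 0)) ≤ LinearMap.range (opr (ph a 0)) := by
  have he : n % 2 = 0 := by omega
  let b : ℕ → Fin n := fun r => Fin.ofNat n (2 * r)
  have hb : ∀ r, par (b r) = 1 := by
    intro r
    simp only [par, b, Fin.val_ofNat]
    apply Even.neg_one_pow
    rw [Nat.even_iff, Nat.mod_mod_of_dvd _ (by omega)]; omega
  have hbinj : ∀ r < n / 2, ∀ s < n / 2, r ≠ s → b s ≠ b r := by
    intro r hr s hs h e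
    have := congrArg Fin.val e
    simp only [b, Fin.val_ofNat] at this
    rw [Nat.mod_eq_of_lt (by omega), Nat.mod_eq_of_lt (by omega)] at this
    omega
  have hex : ∀ r, ∃ y : Fin n → k, (∀ b, par b = 1 → y b = 0) ∧
      ∀ c, par c = 1 → Lam a y c = (Pi.single (b r) 1 : Fin n → k) c := by
    intro r
    obtain ⟨y, hy⟩ := Lam_surj h4 a hP (Pi.single (b r) 1)
    refine ⟨fun c => if par c = 1 then 0 else y c, fun c hc => by simp [hc], fun c hc => ?_⟩
    rw [← hy]
    have h1 : par (c + 1) ≠ 1 := by rw [par_succ he, hc]; decide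
    have h2 : par (c - 1) ≠ 1 := by
      have := par_succ he (c - 1)
      rw [sub_add_cancel] at this
      intro h; rw [h, hc] at this; revert this; decide
    simp [Lam, h1, h2]
  choose y hy1 hy2 using hex
  have hadd : ∀ r s, ∀ c, par c = 1 → (y r + y s) c = 0 := by
    intro r s c hc; simp [hy1 r c hc, hy1 s c hc]
  apply clifford_abs _ _ (n / 2) (fun r => opr (ph1 a (Pi.single (b r) 1)))
    (fun r => opr (ph1 a (y r)))
  · intro r v hv; exact psi_ker hn a _ v hv
  · intro r v hv; exact psi_ker hn a _ v hv
  · intro r v hv; exact psi_range hn a _ v hv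
  · intro r v hv; exact psi_range hn a _ v hv
  · intro r _ v hv
    have := psi_sq_mem hn a (y r) v hv
    rwa [ff_odd he a _ (hy1 r), zero_smul, sub_zero] at this
  · intro r _ s _ v hv
    have := psi_anti hn a (y r) (y s) v hv
    rwa [ff_odd he a _ (hy1 r), ff_odd he a _ (hy1 s), ff_odd he a _ (hadd r s), sub_zero, sub_zero,
      zero_smul, sub_zero] at this
  · intro r hr s hs h v hv
    have := psi_anti hn a (y r) (Pi.single (b s) 1) v hv
    rwa [ff_polar_single hn, hy2 r _ (hb s), Pi.single_eq_of_ne (hbinj r hr s hs h), zero_smul,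
      sub_zero] at this
  · intro r hr v hv
    have := psi_anti hn a (y r) (Pi.single (b r) 1) v hv
    rwa [ff_polar_single hn, hy2 r _ (hb r), Pi.single_eq_same, one_smul] at this
  · intro w hw
    exact psi_nil hn h4 a b hb w hw

end lam
section ker
variable {n : ℕ} [NeZero n] {k : Type*} [Field k]

theorem cyc_ker1 (hn : 3 ≤ n) (α β : Fin n → k) (hβ : ∀ t, β t ≠ 0) (h : ∏ t, α t = ∏ t, β t) :
    ∃ x : Fin n → k, x ≠ 0 ∧ ∀ t, α t * x t = β t * x (t + 1) := by
  let q : ℕ → k := fun m => α (Fin.ofNat n m) / β (Fin.ofNat n m)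
  have hq : ∀ t : Fin n, q t.val = α t / β t := by intro t; simp only [q, ofNat_val]
  refine ⟨fun t => ∏ u ∈ Finset.range t.val, q u, ?_, ?_⟩
  · intro e
    have := congrFun e 0
    simp at this
  · intro t
    have ht : α t = β t * q t.val := by rw [hq, mul_div_cancel₀ _ (hβ t)]
    rcases fin_val_succ t with ⟨h1, _⟩ | ⟨h1, h2⟩
    · simp only [h1, Finset.prod_range_succ]
      rw [ht]; ring
    · simp only [h1, Finset.prod_range_zero, mul_one]
      have : ∏ u ∈ Finset.range n, q u = 1 := by
        rw [Finset.prod_range]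
        simp only [hq, Finset.prod_div_distrib]
        rw [h, div_self (Finset.prod_ne_zero_iff.mpr (fun t _ => hβ t))]
      rw [← h2, Finset.prod_range_succ] at this
      rw [ht]; linear_combination β t * this

theorem cyc_ker2 (hn : 3 ≤ n) (α β : Fin n → k) (r s : Fin n) (hr : β r = 0) (hs : α s = 0) :
    ∃ x : Fin n → k, x ≠ 0 ∧ ∀ t, α t * x t = β t * x (t + 1) := by
  let al : ℕ → k := fun m => α (Fin.ofNat n m + r + 1)
  let be : ℕ → k := fun m => β (Fin.ofNat n m + r + 1)
  have hal : ∀ t : Fin n, al (t - r - 1).val = α t := by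
    intro t; simp only [al, ofNat_val]; congr 1; abel
  have hbe : ∀ t : Fin n, be (t - r - 1).val = β t := by
    intro t; simp only [be, ofNat_val]; congr 1; abel
  have hex : ∃ m, al m = 0 := ⟨_, (hal s).trans hs⟩
  set m := Nat.find hex with hm
  have hm0 : al m = 0 := Nat.find_spec hex
  have hmn : m < n := lt_of_le_of_lt (Nat.find_min' hex ((hal s).trans hs)) (Fin.isLt _)
  have hmin : ∀ u < m, al u ≠ 0 := fun u hu => Nat.find_min hex hu
  let Y : ℕ → k := fun u => if u ≤ m then ∏ t ∈ Finset.Ico u m, be t / al t else 0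
  have hY1 : ∀ u < m, al u * Y u = be u * Y (u + 1) := by
    intro u hu
    simp only [Y, if_pos hu.le, if_pos (Nat.succ_le_of_lt hu)]
    rw [Finset.prod_eq_prod_Ico_succ_bot hu]
    have := hmin u hu
    field_simp
  have hY2 : ∀ u, m < u → Y u = 0 := by
    intro u hu; simp only [Y, if_neg (not_le.mpr hu)]
  refine ⟨fun t => Y (t - r - 1).val, ?_, ?_⟩
  · intro e
    have := congrFun e (Fin.ofNat n m + r + 1)
    have e2 : Fin.ofNat n m + r + 1 - r - 1 = Fin.ofNat n m := by abel
    simp only [e2, Fin.val_ofNat, Nat.mod_eq_of_lt hmn, Y] at this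
    simp at this
  · intro t
    rw [← hal t, ← hbe t]
    simp only
    have e1 : t + 1 - r - 1 = (t - r - 1) + 1 := by abel
    rw [e1]
    set w := t - r - 1 with hw
    rcases fin_val_succ w with ⟨h1, _⟩ | ⟨h1, h2⟩
    · rw [h1]
      rcases lt_trichotomy w.val m with h | h | h
      · exact hY1 _ h
      · rw [h, hm0, hY2 (m + 1) (by omega)]; ring
      · rw [hY2 _ h, hY2 (w.val + 1) (by omega)]; ring
    · have hwr : be w.val = 0 := by
        rw [hw, hbe]
        have : w + 1 = 0 := Fin.ext (by rw [h1, Fin.val_zero])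
        have : t = r := by
          have h3 : w + 1 = t - r := by rw [hw]; abel
          rw [h3] at this
          exact sub_eq_zero.mp this
        rw [this, hr]
      rw [hwr, zero_mul]
      rcases Nat.lt_or_ge m w.val with h | h
      · rw [hY2 _ h, mul_zero]
      · have : w.val = m := by omega
        rw [this, hm0, zero_mul]

theorem cyc_ker (hn : 3 ≤ n) (α β : Fin n → k) (h : ∏ t, α t = ∏ t, β t) :
    ∃ x : Fin n → k, x ≠ 0 ∧ ∀ t, α t * x t = β t * x (t + 1) := by
  by_cases hβ : ∀ t, β t ≠ 0
  · exact cyc_ker1 hn α β hβ h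
  · push Not at hβ
    obtain ⟨r, hr⟩ := hβ
    rw [Finset.prod_eq_zero (Finset.mem_univ r) hr, Finset.prod_eq_zero_iff] at h
    obtain ⟨s, -, hs⟩ := h
    exact cyc_ker2 hn α β r s hr hs

theorem opr_single (φ : Fin n → Finset (Fin n) → k) (σ : Finset (Fin n)) :
    opr φ (Pi.single σ 1) =
      ∑ i, (sg k i σ * φ i (fl σ i)) • (Pi.single (fl σ i) 1 : Finset (Fin n) → k) := by
  funext ρ
  rw [opr_apply, Finset.sum_apply]
  apply Finset.sum_congr rfl
  intro i _
  simp only [Pi.smul_apply, smul_eq_mul]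
  by_cases h : ρ = fl σ i
  · subst h
    rw [fl_fl, sg_fl_self, Pi.single_eq_same, Pi.single_eq_same]
  · have h2 : fl ρ i ≠ σ := fun e => h (by rw [← e, fl_fl])
    rw [Pi.single_eq_of_ne h, Pi.single_eq_of_ne h2]; ring

def sp (N h t : ℕ) : ℕ := h + (if h < t then 1 else 0) + (if h + N < t then 1 else 0)

def st (t : Fin n) : Finset (Fin n) :=
  Finset.univ.filter (fun i => sp (n / 2) (i.val / 2) t.val % 2 = 1)

theorem mem_st (t i : Fin n) : i ∈ st t ↔ sp (n / 2) (i.val / 2) t.val % 2 = 1 := by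
  simp [st]

theorem dbl_val (t : Fin n) : ((t + t).val = 2 * t.val ∧ 2 * t.val < n) ∨
    ((t + t).val + n = 2 * t.val ∧ n ≤ 2 * t.val) := by
  have := t.isLt
  rw [Fin.val_add]
  rcases Nat.lt_or_ge (2 * t.val) n with h | h
  · left; rw [Nat.mod_eq_of_lt (by omega)]; omega
  · right; rw [Nat.mod_eq_sub_mod (by omega), Nat.mod_eq_of_lt (by omega)]; omega

theorem fin_val_pred (b : Fin n) : ((b - 1 : Fin n).val + 1 = b.val) ∨
    (b.val = 0 ∧ (b - 1 : Fin n).val + 1 = n) := by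
  have := fin_val_succ (b - 1)
  rw [sub_add_cancel] at this
  omega

theorem st_pair_even (h4 : n % 4 = 2) (t i : Fin n) (hi : i.val % 2 = 0) :
    i ∈ st t ↔ i + 1 ∈ st t := by
  rw [mem_st, mem_st]
  have h1 := i.isLt
  have := fin_val_succ i
  have e : (i + 1).val / 2 = i.val / 2 := by omega
  rw [e]

theorem st_pair_odd (h4 : n % 4 = 2) (t i : Fin n) (hi : i.val % 2 = 1) :
    i - 1 ∈ st t ↔ i ∈ st t := by
  have := fin_val_pred i
  have h := st_pair_even h4 t (i - 1) (by omega)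
  rwa [sub_add_cancel] at h

theorem st_left (hn : 3 ≤ n) (h4 : n % 4 = 2) (t i : Fin n) (hi : i.val % 2 = 0) :
    (i - 1 ∈ st t ↔ i ∈ st t) ↔ i = t + t := by
  rw [mem_st, mem_st, ← Fin.val_inj]
  have h1 := i.isLt
  have h2 := t.isLt
  have h3 := fin_val_pred i
  have h5 := dbl_val t
  obtain ⟨N, hN⟩ : ∃ N, N = n / 2 := ⟨_, rfl⟩
  obtain ⟨h, hh⟩ : ∃ h, h = i.val / 2 := ⟨_, rfl⟩
  obtain ⟨g, hg⟩ : ∃ g, g = (i - 1).val / 2 := ⟨_, rfl⟩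
  rw [← hN, ← hh, ← hg]
  have hgh : g + 1 = h ∨ (h = 0 ∧ g + 1 = N) := by omega
  unfold sp
  split_ifs <;> omega

theorem st_right (hn : 3 ≤ n) (h4 : n % 4 = 2) (t i : Fin n) (hi : i.val % 2 = 1) :
    (i ∈ st t ↔ i + 1 ∈ st t) ↔ i = t + t - 1 := by
  have h := fin_val_succ i
  have := st_left hn h4 t (i + 1) (by omega)
  rw [add_sub_cancel_right] at this
  rw [this]
  exact eq_sub_iff_add_eq.symm

theorem st_color (hn : 3 ≤ n) (h4 : n % 4 = 2) (t : Fin n) : t + t ∈ st t ↔ t.val % 2 = 1 := by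
  rw [mem_st]
  have h2 := t.isLt
  have h5 := dbl_val t
  unfold sp
  split_ifs <;> omega

theorem st_flip (hn : 3 ≤ n) (h4 : n % 4 = 2) (t : Fin n) :
    fl (st (t + 1)) (t + 1 + (t + 1) - 1) = fl (st t) (t + t) := by
  ext i
  have e : t + 1 + (t + 1) - 1 = t + t + 1 := by abel
  rw [e, mem_fl, mem_fl, mem_st, mem_st, ← Fin.val_inj, ← Fin.val_inj]
  have h1 := i.isLt
  have h2 := t.isLt
  have h3 := fin_val_succ (t + t)
  have h6 := fin_val_succ t
  have h5 := dbl_val t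
  unfold sp
  split_ifs <;> omega

end ker
section fin
variable {n : ℕ} [NeZero n] {k : Type*} [Field k]

theorem st_prod (hn : 3 ≤ n) (h4 : n % 4 = 2) (t : Fin n) :
    ∏ j : Fin n, (if j ∈ st t then (-1 : ℤ) else 1) = 1 := by
  apply Finset.prod_involution (s := Finset.univ) (fun j _ => if j.val % 2 = 0 then j + 1 else j - 1)
  · intro j _
    by_cases h : j.val % 2 = 0
    · simp only [if_pos h, ← st_pair_even h4 t j h]
      split_ifs <;> norm_num
    · simp only [if_neg h, st_pair_odd h4 t j (by omega)]
      split_ifs <;> norm_num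
  · intro j _ _
    by_cases h : j.val % 2 = 0
    · simp only [if_pos h]; exact ne1 hn j
    · simp only [if_neg h]; exact ne2 hn j
  · intro j _
    by_cases h : j.val % 2 = 0
    · have := fin_val_succ j
      have h2 : ¬ (j + 1).val % 2 = 0 := by omega
      simp only [if_pos h, if_neg h2, add_sub_cancel_right]
    · have := fin_val_pred j
      have h2 : (j - 1).val % 2 = 0 := by omega
      simp only [if_neg h, if_pos h2, sub_add_cancel]
  · intro j _; exact Finset.mem_univ _

theorem edgeSign_step (σ : Finset (Fin n))
    (hσ : ∏ j : Fin n, (if j ∈ σ then (-1 : ℤ) else 1) = 1) (i : Fin n) :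
    edgeSign σ i = edgeSign σ (i - 1) * (if i - 1 ∈ σ then (-1 : ℤ) else 1) := by
  rw [edgeSign_prod, edgeSign_prod, mul_comm]
  have hnot : i - 1 ∉ Finset.univ.filter (fun j : Fin n => j < i - 1) := by simp
  rw [← Finset.prod_insert (f := fun j => if j ∈ σ then (-1 : ℤ) else 1) hnot]
  have hp := fin_val_pred i
  rcases hp with h | ⟨h, h'⟩
  · apply Finset.prod_congr _ (fun _ _ => rfl)
    ext j
    simp only [Finset.mem_filter, Finset.mem_univ, true_and, Finset.mem_insert, Fin.lt_def,
      ← Fin.val_inj]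
    omega
  · have e1 : Finset.univ.filter (fun j : Fin n => j < i) = ∅ := by
      ext j
      simp only [Finset.mem_filter, Finset.mem_univ, true_and, Fin.lt_def, Finset.notMem_empty, iff_false, not_lt]
      omega
    have e2 : insert (i - 1) (Finset.univ.filter (fun j : Fin n => j < i - 1)) = Finset.univ := by
      ext j
      have := j.isLt
      simp only [Finset.mem_filter, Finset.mem_univ, true_and, Finset.mem_insert, Fin.lt_def,
        ← Fin.val_inj, iff_true]
      omega
    rw [e1, e2, hσ, Finset.prod_empty]

def cA (a : Fin n → k) (t : Fin n) : k :=
  sg k (t + t) (st t) * (if t.val % 2 = 0 then a (t + t) else 1)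
def cB (a : Fin n → k) (t : Fin n) : k :=
  sg k (t + t - 1) (st t) * (if t.val % 2 = 0 then a (t + t - 1) else 1)

theorem dbl_even (he : n % 2 = 0) (t : Fin n) : (t + t).val % 2 = 0 := by
  have := dbl_val t; omega

theorem st_color' (hn : 3 ≤ n) (h4 : n % 4 = 2) (t : Fin n) :
    t + t - 1 ∈ st t ↔ t.val % 2 = 1 := by
  rw [← st_color hn h4 t]
  exact (st_left hn h4 t (t + t) (dbl_even (by omega) t)).mpr rfl

theorem kap_zero_fl_left (hn : 3 ≤ n) (σ : Finset (Fin n)) (i : Fin n) :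
    kap (0 : Fin n → k) (fl σ i) i = if (i ∈ σ ↔ i + 1 ∈ σ) then 1 else 0 := by
  unfold kap
  simp only [mem_fl_self, mem_fl_ne σ (ne1 hn i), Pi.zero_apply]
  by_cases h : i ∈ σ <;> by_cases h' : i + 1 ∈ σ <;> simp [h, h']

theorem kap_zero_fl_right (hn : 3 ≤ n) (σ : Finset (Fin n)) (i : Fin n) :
    kap (0 : Fin n → k) (fl σ i) (i - 1) = if (i - 1 ∈ σ ↔ i ∈ σ) then 1 else 0 := by
  unfold kap
  simp only [sub_add_cancel, mem_fl_self, mem_fl_ne σ (ne2 hn i), Pi.zero_apply]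
  by_cases h : i ∈ σ <;> by_cases h' : i - 1 ∈ σ <;> simp [h, h']

theorem D_st (hn : 3 ≤ n) (h4 : n % 4 = 2) (a : Fin n → k) (t : Fin n) :
    opr (ph a 0) (Pi.single (st t) 1) =
      cA a t • (Pi.single (fl (st t) (t + t)) 1 : Finset (Fin n) → k)
      + cB a t • (Pi.single (fl (st t) (t + t - 1)) 1 : Finset (Fin n) → k) := by
  have hev := dbl_even (by omega) t
  have hod : (t + t - 1).val % 2 = 1 := by
    have := fin_val_pred (t + t); omega
  rw [opr_single]
  have hss : ∑ i, (sg k i (st t) * ph a 0 i (fl (st t) i)) •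
        (Pi.single (fl (st t) i) 1 : Finset (Fin n) → k)
      = ∑ i ∈ {t + t, t + t - 1}, (sg k i (st t) * ph a 0 i (fl (st t) i)) •
        (Pi.single (fl (st t) i) 1 : Finset (Fin n) → k) := by
    symm
    apply Finset.sum_subset (Finset.subset_univ _)
    intro i _ hi
    simp only [Finset.mem_insert, Finset.mem_singleton, not_or] at hi
    have : ph a 0 i (fl (st t) i) = 0 := by
      unfold ph
      rw [kap_zero_fl_left hn, kap_zero_fl_right hn]
      by_cases h : i.val % 2 = 0
      · rw [if_neg (fun e => hi.1 ((st_left hn h4 t i h).mp e))]; ring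
      · rw [if_neg (c := (i ∈ st t ↔ i + 1 ∈ st t))
          (fun e => hi.2 ((st_right hn h4 t i (by omega)).mp e))]; ring
    rw [this, mul_zero, zero_smul]
  rw [hss, Finset.sum_pair (ne2 hn (t + t)).symm]
  congr 2
  · unfold cA ph
    rw [kap_zero_fl_left hn, kap_zero_fl_right hn, if_pos ((st_left hn h4 t _ hev).mpr rfl),
      if_pos (st_pair_even h4 t _ hev), Am]
    simp only [mem_fl_self, st_color hn h4]
    rcases Nat.mod_two_eq_zero_or_one t.val with h | h <;> simp [h]
  · unfold cB ph
    rw [kap_zero_fl_left hn, kap_zero_fl_right hn, if_pos ((st_right hn h4 t _ hod).mpr rfl),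
      if_pos (st_pair_odd h4 t _ hod), Am]
    simp only [mem_fl_self, st_color' hn h4]
    rcases Nat.mod_two_eq_zero_or_one t.val with h | h <;> simp [h]

theorem par_prod (h4 : n % 4 = 2) : ∏ t : Fin n, ((par t : ℤ) : k) = -1 := by
  have : ∏ t : Fin n, par t = -1 := by
    unfold par
    rw [Fin.prod_univ_eq_prod_range (fun m => (-1 : ℤ) ^ m) n, Finset.prod_pow_eq_pow_sum,
      Finset.sum_range_id]
    apply Odd.neg_one_pow
    obtain ⟨m, hm⟩ : ∃ m, n = 4 * m + 2 := ⟨n / 4, by omega⟩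
    have e : n * (n - 1) = 2 * ((2 * m + 1) * (4 * m + 1)) := by
      rw [hm, show 4 * m + 2 - 1 = 4 * m + 1 by omega]; ring
    rw [e, Nat.mul_div_cancel_left _ (by norm_num)]
    exact Odd.mul ⟨m, rfl⟩ ⟨2 * m, by ring⟩
  rw [← Int.cast_prod, this]; simp

theorem prodA (h4 : n % 4 = 2) (a : Fin n → k) :
    ∏ t : Fin n, (if t.val % 2 = 0 then a (t + t) else 1)
      = ∏ i ∈ Finset.univ.filter (fun i : Fin n => i.val % 2 = 0), a i := by
  rw [← Finset.prod_filter]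
  apply Finset.prod_bij (fun t _ => t + t)
  · intro t _
    simpa using dbl_even (by omega) t
  · intro t ht s hs h
    simp only [Finset.mem_filter, Finset.mem_univ, true_and] at ht hs
    have h1 := dbl_val t
    have h2 := dbl_val s
    rw [h] at h1
    have := t.isLt
    have := s.isLt
    apply Fin.ext; omega
  · intro i hi
    simp only [Finset.mem_filter, Finset.mem_univ, true_and] at hi
    have h1 := i.isLt
    by_cases h : i.val / 2 % 2 = 0
    · have hlt : i.val / 2 < n := by omega
      refine ⟨⟨i.val / 2, hlt⟩, by simpa using h, ?_⟩
      have := dbl_val (⟨i.val / 2, hlt⟩ : Fin n)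
      apply Fin.ext
      simp only at this
      omega
    · have hlt : i.val / 2 + n / 2 < n := by omega
      refine ⟨⟨i.val / 2 + n / 2, hlt⟩, by simp; omega, ?_⟩
      have := dbl_val (⟨i.val / 2 + n / 2, hlt⟩ : Fin n)
      apply Fin.ext
      simp only at this
      omega
  · intros; rfl

theorem prodB (h4 : n % 4 = 2) (a : Fin n → k) :
    ∏ t : Fin n, (if t.val % 2 = 0 then a (t + t - 1) else 1)
      = ∏ i ∈ Finset.univ.filter (fun i : Fin n => i.val % 2 = 1), a i := by
  rw [prodA h4 (fun i => a (i - 1))]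
  apply Finset.prod_bij (fun t _ => t - 1)
  · intro t ht
    simp only [Finset.mem_filter, Finset.mem_univ, true_and] at ht ⊢
    have := fin_val_pred t
    omega
  · intro t _ s _ h
    exact sub_left_injective h
  · intro i hi
    simp only [Finset.mem_filter, Finset.mem_univ, true_and] at hi
    have := fin_val_succ i
    exact ⟨i + 1, by simp only [Finset.mem_filter, Finset.mem_univ, true_and]; omega, by simp⟩
  · intros; rfl

theorem sg_ratio (hn : 3 ≤ n) (h4 : n % 4 = 2) (t : Fin n) :
    sg k (t + t) (st t) = sg k (t + t - 1) (st t) * ((par t : ℤ) : k) := by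
  unfold sg
  rw [← Int.cast_mul, edgeSign_step _ (st_prod hn h4 t) (t + t)]
  congr 2
  simp only [st_color' hn h4, par]
  rcases Nat.mod_two_eq_zero_or_one t.val with h | h
  · rw [if_neg (by omega), (Nat.even_iff.mpr h).neg_one_pow]
  · rw [if_pos h, (Nat.odd_iff.mpr h).neg_one_pow]

theorem prod_rel (hn : 3 ≤ n) (h4 : n % 4 = 2) (a : Fin n → k)
    (hP : (∏ i ∈ Finset.univ.filter (fun i : Fin n => i.val % 2 = 0), a i) +
          (∏ i ∈ Finset.univ.filter (fun i : Fin n => i.val % 2 = 1), a i) = 0) :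
    ∏ t, cA a t = ∏ t, - cB a (t + 1) := by
  have e1 : ∏ t : Fin n, - cB a (t + 1) = ∏ t : Fin n, - cB a t :=
    Equiv.prod_comp (Equiv.addRight (1 : Fin n)) (fun t => - cB a t)
  have e2 : ∏ t : Fin n, - cB a t = ∏ t, cB a t := by
    rw [Finset.prod_neg]
    have : Even (Finset.univ : Finset (Fin n)).card := by
      rw [Finset.card_univ, Fintype.card_fin, Nat.even_iff]; omega
    rw [this.neg_one_pow, one_mul]
  rw [e1, e2]
  unfold cA cB
  rw [Finset.prod_mul_distrib, Finset.prod_mul_distrib, prodA h4, prodB h4]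
  simp only [sg_ratio hn h4, Finset.prod_mul_distrib]
  rw [par_prod h4]
  linear_combination (- ∏ t : Fin n, sg k (t + t - 1) (st t)) * hP

theorem st_inj (hn : 3 ≤ n) (h4 : n % 4 = 2) : Function.Injective (st : Fin n → Finset (Fin n)) := by
  intro t s h
  have h1 := (st_left hn h4 t (t + t) (dbl_even (by omega) t)).mpr rfl
  rw [h] at h1
  have h2 := (st_left hn h4 s (t + t) (dbl_even (by omega) t)).mp h1
  have h3 := st_color hn h4 t
  rw [h, h2, st_color hn h4 s] at h3
  have h5 := dbl_val t
  have h6 := dbl_val s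
  rw [h2] at h5
  have := t.isLt
  have := s.isLt
  apply Fin.ext
  omega

theorem row_zero (hn : 3 ≤ n) (h4 : n % 4 = 2) (a : Fin n → k) (t i : Fin n) :
    ph a 0 i (st t) = 0 := by
  unfold ph kap
  rw [sub_add_cancel]
  rcases Nat.mod_two_eq_zero_or_one i.val with h | h
  · rw [if_pos (c := (i ∈ st t ↔ i + 1 ∈ st t)) (st_pair_even h4 t i h)]; simp
  · rw [if_pos (c := (i - 1 ∈ st t ↔ i ∈ st t)) (st_pair_odd h4 t i h)]; simp

theorem nonexact_case (hn : 3 ≤ n) (h4 : n % 4 = 2) (a : Fin n → k)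
    (hP : (∏ i ∈ Finset.univ.filter (fun i : Fin n => i.val % 2 = 0), a i) +
          (∏ i ∈ Finset.univ.filter (fun i : Fin n => i.val % 2 = 1), a i) = 0) :
    ∃ v, opr (ph a 0) v = 0 ∧ ∀ u, opr (ph a 0) u ≠ v := by
  obtain ⟨x, hx0, hx⟩ := cyc_ker hn (cA a) (fun t => - cB a (t + 1)) (prod_rel hn h4 a hP)
  refine ⟨∑ t, x t • (Pi.single (st t) 1 : Finset (Fin n) → k), ?_, ?_⟩
  · rw [map_sum]
    simp only [map_smul, D_st hn h4, smul_add, smul_smul, Finset.sum_add_distrib]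
    have e := Equiv.sum_comp (Equiv.addRight (1 : Fin n)) (fun t => (x t * cB a t) •
      (Pi.single (fl (st t) (t + t - 1)) 1 : Finset (Fin n) → k))
    rw [← e, ← Finset.sum_add_distrib]
    apply Finset.sum_eq_zero
    intro t _
    simp only [Equiv.coe_addRight]
    rw [st_flip hn h4, ← add_smul]
    have : x t * cA a t + x (t + 1) * cB a (t + 1) = 0 := by
      linear_combination hx t
    rw [this, zero_smul]
  · intro u hu
    apply hx0
    funext t
    have h1 := congrFun hu (st t)
    rw [opr_apply] at h1
    simp only [row_zero hn h4, mul_zero, zero_mul, Finset.sum_const_zero] at h1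
    rw [Finset.sum_apply, Finset.sum_eq_single t] at h1
    · simpa using h1.symm
    · intro s _ hs
      have : st t ≠ st s := fun e => hs (st_inj hn h4 e).symm
      simp [Pi.single_eq_of_ne this]
    · simp

end fin
/-- Theorem B: the support variety of the edge ideal of an `n`-cycle.  With `0`-indexing,
`χ_1 χ_3 ⋯ χ_{n-1}` is the product over coordinates of even index and
`χ_2 χ_4 ⋯ χ_n` the product over coordinates of odd index. -/
theorem cycle_edge_ideal_support (k : Type*) [Field k] [IsAlgClosed k]
    (n : ℕ) [NeZero n] (hn : 3 ≤ n) :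
    (n % 4 = 2 → supportVariety k (cycleEdges n) =
      {a : Fin n → k |
        (∏ i ∈ Finset.univ.filter fun i : Fin n => i.val % 2 = 0, a i) +
          (∏ i ∈ Finset.univ.filter fun i : Fin n => i.val % 2 = 1, a i) = 0}) ∧
    (n % 4 ≠ 2 → supportVariety k (cycleEdges n) = Set.univ) := by
  refine ⟨fun h4 => ?_, fun h4 => ?_⟩
  · ext a
    rw [mem_support_iff hn, Set.mem_setOf_eq]
    constructor
    · rintro ⟨v, hv, hu⟩
      by_contra hP
      obtain ⟨u, hu'⟩ := exact_case hn h4 a hP (LinearMap.mem_ker.mpr hv)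
      exact hu u hu'
    · intro hP
      exact nonexact_case hn h4 a hP
  · exact Set.eq_univ_of_forall (fun a => euler_case hn h4 a)
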